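/- arXiv:1902.10765 — 3 statements merged into one kernel-verified Lean document; each statement's English description precedes it below -/
import Mathlib

section
/- Let G be a finite simple connected graph and k ∈ ℕ with 1 ≤ k ≤ |V(G)|. The switch graph Γ_k(G) is connected if and only if k = 1 or every k-district map of G is contractible (i.e., Γ_k(G) = Γ_k'(G)). -/
open SimpleGraph

universe u

/-- A vertex `v` is a cut vertex of `G` if its removal disconnects `G`. -/
def IsCutVertex {V : Type u} (G : SimpleGraph V) (v : V) : Prop :=
  ¬ (G.induce ({v}ᶜ : Set V)).Connected

/-- `G` is biconnected: it is connected and either consists of a single edge or has at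
least three vertices and remains connected after the deletion of any single vertex. -/
def Biconnected {V : Type u} (G : SimpleGraph V) : Prop :=
  G.Connected ∧
  ((∃ a b : V, a ≠ b ∧ G.Adj a b ∧ (Set.univ : Set V) = {a, b}) ∨
   (3 ≤ Nat.card V ∧ ∀ v : V, (G.induce ({v}ᶜ : Set V)).Connected))

/-- A set of vertices inducing a biconnected subgraph of `G`. -/
def IsBiconnectedSet {V : Type u} (G : SimpleGraph V) (s : Set V) : Prop :=
  (G.induce s).Connected ∧
  ((∃ a b : V, a ≠ b ∧ G.Adj a b ∧ s = {a, b}) ∨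
   (3 ≤ s.ncard ∧ ∀ v ∈ s, (G.induce (s \ {v})).Connected))

/-- A block of `G`: the vertex set of a maximal biconnected subgraph. -/
def IsBlock {V : Type u} (G : SimpleGraph V) (s : Set V) : Prop :=
  IsBiconnectedSet G s ∧ ∀ t : Set V, IsBiconnectedSet G t → s ⊆ t → t = s

/-- A leaf block of `G`: a block that is a leaf of the block tree, i.e. a block
containing at most one cut vertex of `G`. -/
def IsLeafBlock {V : Type u} (G : SimpleGraph V) (s : Set V) : Prop :=
  IsBlock G s ∧ ({v ∈ s | IsCutVertex G v}).ncard ≤ 1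

/-- A `k`-district map of `G`: a partition of the vertex set of `G` into `k` nonempty
subsets (districts), each of which induces a connected subgraph of `G`. -/
structure DistrictMap {V : Type u} (G : SimpleGraph V) (k : ℕ) where
  parts : Set (Set V)
  ncard_parts : parts.ncard = k
  nonempty_mem : ∀ s ∈ parts, s.Nonempty
  pairwise_disjoint : parts.Pairwise Disjoint
  covers : ∀ v : V, ∃ s ∈ parts, v ∈ s
  connected_mem : ∀ s ∈ parts, (G.induce s).Connected

section SwitchDefs

variable {V : Type u} {G : SimpleGraph V} {k : ℕ}

/-- The switch operation `switch_P(u,v,w)` is defined: `(u,v,w)` is a path of `G`,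
`P(u) = P(v) ≠ P(w)`, and `P(v) \ {v}` is nonempty and induces a connected subgraph. -/
def SwitchDefined (P : DistrictMap G k) (u v w : V) : Prop :=
  ∃ su sw : Set V,
    G.Adj u v ∧ G.Adj v w ∧
    su ∈ P.parts ∧ sw ∈ P.parts ∧ u ∈ su ∧ v ∈ su ∧ w ∈ sw ∧ su ≠ sw ∧
    (su \ {v} : Set V).Nonempty ∧ (G.induce (su \ {v})).Connected

/-- `Q = switch_P(u,v,w)`: the district map obtained from `P` by moving `v`
from `P(v)` to `P(w)`. -/
def SwitchedAt (P Q : DistrictMap G k) (u v w : V) : Prop :=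
  ∃ su sw : Set V,
    G.Adj u v ∧ G.Adj v w ∧
    su ∈ P.parts ∧ sw ∈ P.parts ∧ u ∈ su ∧ v ∈ su ∧ w ∈ sw ∧ su ≠ sw ∧
    (su \ {v} : Set V).Nonempty ∧ (G.induce (su \ {v})).Connected ∧
    Q.parts = (P.parts \ {su, sw}) ∪ {su \ {v}, insert v sw}

/-- `Q` is obtained from `P` by a single switch. -/
def Switch (P Q : DistrictMap G k) : Prop := ∃ u v w : V, SwitchedAt P Q u v w

/-- Adjacency in the switch graph `Γ_k(G)`. -/
def SwitchAdj (P Q : DistrictMap G k) : Prop := Switch P Q ∨ Switch Q P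

/-- `f 0, f 1, …, f m` is a walk in the switch graph `Γ_k(G)`. -/
def SwitchChain (f : ℕ → DistrictMap G k) (m : ℕ) : Prop :=
  ∀ i < m, SwitchAdj (f i) (f (i + 1))

/-- A single switch taking `P` to `Q` that contracts the district `s` to `s' = s \ {v}`. -/
def SwitchOut (P Q : DistrictMap G k) (s s' : Set V) : Prop :=
  ∃ u v w : V, ∃ sw : Set V,
    G.Adj u v ∧ G.Adj v w ∧
    s ∈ P.parts ∧ sw ∈ P.parts ∧ u ∈ s ∧ v ∈ s ∧ w ∈ sw ∧ s ≠ sw ∧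
    s' = s \ {v} ∧ s'.Nonempty ∧ (G.induce s').Connected ∧
    Q.parts = (P.parts \ {s, sw}) ∪ {s', insert v sw}

/-- District `s` of `P` can be contracted to the singleton `{t}` by a sequence
of `|s| - 1` switches. -/
def ContractibleTo (P : DistrictMap G k) (s : Set V) (t : V) : Prop :=
  s ∈ P.parts ∧
  ∃ (f : ℕ → DistrictMap G k) (g : ℕ → Set V),
    f 0 = P ∧ g 0 = s ∧ g (s.ncard - 1) = {t} ∧
    ∀ i < s.ncard - 1, SwitchOut (f i) (f (i + 1)) (g i) (g (i + 1))

/-- District `s` of `P` is contractible. -/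
def ContractibleDistrict (P : DistrictMap G k) (s : Set V) : Prop :=
  ∃ t : V, ContractibleTo P s t

/-- A district map is contractible if all of its districts are contractible. -/
def ContractibleMap (P : DistrictMap G k) : Prop :=
  ∀ s ∈ P.parts, ContractibleDistrict P s

end SwitchDefs

/-- A diamond in `G`: an induced subgraph determined by two cut vertices `v₁, v₂` of `G`
connected by `m ≥ 2` internally disjoint paths, of which at least `m - 1` have exactly one
interior vertex, together with dangling paths from `v₁` and `v₂` to leaves `u₁` and `u₂`. -/
structure Diamond {V : Type u} (G : SimpleGraph V) where
  v₁ : V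
  v₂ : V
  u₁ : V
  u₂ : V
  m : ℕ
  two_le_m : 2 ≤ m
  ne_v : v₁ ≠ v₂
  path : Fin m → G.Walk v₁ v₂
  path_isPath : ∀ i, (path i).IsPath
  internally_disjoint : ∀ i j, i ≠ j →
    {x | x ∈ (path i).support} ∩ {x | x ∈ (path j).support} = {v₁, v₂}
  short : ({i | (path i).length ≠ 2} : Set (Fin m)).ncard ≤ 1
  cut₁ : IsCutVertex G v₁
  cut₂ : IsCutVertex G v₂
  dang₁ : G.Walk v₁ u₁
  dang₂ : G.Walk v₂ u₂
  dang₁_isPath : dang₁.IsPath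
  dang₂_isPath : dang₂.IsPath
  leaf₁ : (G.neighborSet u₁).ncard = 1
  leaf₂ : (G.neighborSet u₂).ncard = 1
  dang₁_disjoint : ∀ i, {x | x ∈ dang₁.support} ∩ {x | x ∈ (path i).support} = {v₁}
  dang₂_disjoint : ∀ i, {x | x ∈ dang₂.support} ∩ {x | x ∈ (path i).support} = {v₂}
  dang_disjoint : {x | x ∈ dang₁.support} ∩ {x | x ∈ dang₂.support} = ∅
  induced : ∀ x y : V,
    x ∈ ({x | ∃ i, x ∈ (path i).support} ∪ {x | x ∈ dang₁.support} ∪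
          {x | x ∈ dang₂.support} : Set V) →
    y ∈ ({x | ∃ i, x ∈ (path i).support} ∪ {x | x ∈ dang₁.support} ∪
          {x | x ∈ dang₂.support} : Set V) →
    G.Adj x y →
    (∃ i, s(x, y) ∈ (path i).edges) ∨ s(x, y) ∈ dang₁.edges ∨ s(x, y) ∈ dang₂.edges

/-- A diamond chain of length `r` in `G`: `r` diamonds `A₁, …, A_r`, where diamond `Aᵢ`
has cut vertices `v₁ i`, `v₂ i`, left path through `a i` and right path through `a (i+1)`
(each with exactly one interior vertex), the interior vertex of the right path of `Aᵢ`
being identified with the interior vertex of the left path of `Aᵢ₊₁`, and leaves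
`u₁ i`, `u₂ i` attached by single edges to the cut vertices; the `5r + 1` vertices are
pairwise distinct and each diamond is an induced subgraph of `G`. -/
structure DiamondChain {V : Type u} (G : SimpleGraph V) (r : ℕ) where
  v₁ : Fin r → V
  v₂ : Fin r → V
  a : Fin (r + 1) → V
  u₁ : Fin r → V
  u₂ : Fin r → V
  adj₁ : ∀ i : Fin r, G.Adj (v₁ i) (a i.castSucc)
  adj₂ : ∀ i : Fin r, G.Adj (a i.castSucc) (v₂ i)
  adj₃ : ∀ i : Fin r, G.Adj (v₁ i) (a i.succ)
  adj₄ : ∀ i : Fin r, G.Adj (a i.succ) (v₂ i)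
  adj_u₁ : ∀ i : Fin r, G.Adj (v₁ i) (u₁ i)
  adj_u₂ : ∀ i : Fin r, G.Adj (v₂ i) (u₂ i)
  leaf₁ : ∀ i : Fin r, (G.neighborSet (u₁ i)).ncard = 1
  leaf₂ : ∀ i : Fin r, (G.neighborSet (u₂ i)).ncard = 1
  cut₁ : ∀ i : Fin r, IsCutVertex G (v₁ i)
  cut₂ : ∀ i : Fin r, IsCutVertex G (v₂ i)
  card_support :
    ({x | (∃ i, x = v₁ i) ∨ (∃ i, x = v₂ i) ∨ (∃ i, x = a i) ∨ (∃ i, x = u₁ i) ∨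
      (∃ i, x = u₂ i)} : Set V).ncard = 5 * r + 1
  induced : ∀ i : Fin r, ∀ x y : V,
    x ∈ ({v₁ i, v₂ i, a i.castSucc, a i.succ, u₁ i, u₂ i} : Set V) →
    y ∈ ({v₁ i, v₂ i, a i.castSucc, a i.succ, u₁ i, u₂ i} : Set V) →
    G.Adj x y →
    s(x, y) ∈ ({s(v₁ i, a i.castSucc), s(a i.castSucc, v₂ i), s(v₁ i, a i.succ),
      s(a i.succ, v₂ i), s(v₁ i, u₁ i), s(v₂ i, u₂ i)} : Set (Sym2 V))

/-- The vertex set of a diamond chain. -/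
def DiamondChain.support {V : Type u} {G : SimpleGraph V} {r : ℕ}
    (C : DiamondChain G r) : Set V :=
  {x | (∃ i, x = C.v₁ i) ∨ (∃ i, x = C.v₂ i) ∨ (∃ i, x = C.a i) ∨ (∃ i, x = C.u₁ i) ∨
    (∃ i, x = C.u₂ i)}

namespace SwitchGraph

section Connectivity

variable {V : Type u} {G : SimpleGraph V}

/-- Connectivity of a vertex set, phrased through cuts: `S` is nonempty and no proper nonempty
subset of `S` is closed under adjacency within `S`. -/
def Conn (G : SimpleGraph V) (S : Set V) : Prop :=
  S.Nonempty ∧ ∀ A ⊆ S, A.Nonempty → (∀ a ∈ A, ∀ b ∈ S, G.Adj a b → b ∈ A) → S ⊆ A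

theorem conn_iff {S : Set V} : Conn G S ↔ (G.induce S).Connected := by
  constructor
  · rintro ⟨hne, h⟩
    have : Nonempty S := hne.to_subtype
    refine ⟨fun x y => ?_⟩
    have key := h {z | ∃ hz : z ∈ S, (G.induce S).Reachable x ⟨z, hz⟩} (fun z hz => hz.1)
      ⟨x, x.2, SimpleGraph.Reachable.refl _⟩ (by
        rintro a ⟨ha, hxa⟩ b hb hab
        exact ⟨hb, hxa.trans (SimpleGraph.Adj.reachable (by simpa using hab))⟩)
    exact (key y.2).2
  · intro h
    obtain ⟨x0⟩ := h.nonempty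
    refine ⟨⟨x0, x0.2⟩, fun A hA ⟨a, ha⟩ hcl s hs => ?_⟩
    have hr := h.preconnected ⟨a, hA ha⟩ ⟨s, hs⟩
    rw [SimpleGraph.reachable_iff_reflTransGen] at hr
    have : ∀ z : S, Relation.ReflTransGen (G.induce S).Adj ⟨a, hA ha⟩ z → (z : V) ∈ A := by
      intro z hz
      induction hz with
      | refl => exact ha
      | tail _ hbc ih => exact hcl _ ih _ (Subtype.property _) (by simpa using hbc)
    exact this _ hr

theorem Conn.exists_adj {S A : Set V} (h : Conn G S) (hA : A ⊆ S) (hne : A.Nonempty)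
    {b : V} (hb : b ∈ S) (hbA : b ∉ A) : ∃ x ∈ A, ∃ y ∈ S, y ∉ A ∧ G.Adj x y := by
  by_contra hcon
  push Not at hcon
  exact hbA (h.2 A hA hne (fun a ha c hc hac => by
    by_contra hcA
    exact hcon a ha c hc hcA hac) hb)

theorem conn_singleton (v : V) : Conn G {v} := by
  refine ⟨⟨v, rfl⟩, ?_⟩
  rintro A hA ⟨a, ha⟩ _ x hx
  have h1 : a = v := hA ha
  have h2 : x = v := hx
  rw [h2, ← h1]
  exact ha

protected theorem Conn.insert {S : Set V} (h : Conn G S) {v w : V} (hw : w ∈ S) (hvw : G.Adj v w) :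
    Conn G (insert v S) := by
  refine ⟨⟨v, Or.inl rfl⟩, fun A hA hne hcl => ?_⟩
  have hSA : S ⊆ A := by
    by_cases hi : (A ∩ S).Nonempty
    · exact (h.2 (A ∩ S) Set.inter_subset_right hi
        (fun a ha b hb hab => ⟨hcl a ha.1 b (Or.inr hb) hab, hb⟩)).trans Set.inter_subset_left
    · obtain ⟨a, ha⟩ := hne
      rcases hA ha with rfl | haS
      · exact absurd ⟨w, hcl _ ha w (Or.inr hw) hvw, hw⟩ hi
      · exact absurd ⟨a, ha, haS⟩ hi
  rintro x (rfl | hx)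
  · exact hcl w (hSA hw) x (Or.inl rfl) hvw.symm
  · exact hSA hx

/-- A vertex `y` of `T` lies in a connected subset of `T` closed under adjacency in `T`. -/
theorem exists_component (G : SimpleGraph V) {T : Set V} {y : V} (hy : y ∈ T) :
    ∃ C ⊆ T, y ∈ C ∧ Conn G C ∧ ∀ a ∈ C, ∀ b ∈ T, G.Adj a b → b ∈ C := by
  let C : Set V := {z | z ∈ T ∧ ∀ A ⊆ T, y ∈ A → (∀ a ∈ A, ∀ b ∈ T, G.Adj a b → b ∈ A) → z ∈ A}
  have hyC : y ∈ C := ⟨hy, fun A _ h _ => h⟩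
  have hcl : ∀ a ∈ C, ∀ b ∈ T, G.Adj a b → b ∈ C := fun a ha b hb hab =>
    ⟨hb, fun A hA hyA hA' => hA' a (ha.2 A hA hyA hA') b hb hab⟩
  refine ⟨C, fun z hz => hz.1, hyC, ⟨⟨y, hyC⟩, fun A hA hne hAcl => ?_⟩, hcl⟩
  by_cases hyA : y ∈ A
  · exact fun z hz => hz.2 A (fun x hx => (hA hx).1) hyA
      (fun a ha b hb hab => hAcl a ha b (hcl a (hA ha) b hb hab) hab)
  · obtain ⟨a, ha⟩ := hne
    have := (hA ha).2 (C \ A) (fun x hx => hx.1.1) ⟨hyC, hyA⟩ (fun b hb d hd hbd =>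
      ⟨hcl b hb.1 d hd hbd, fun hdA => hb.2 (hAcl d hdA b hb.1 hbd.symm)⟩)
    exact absurd ha this.2

theorem exists_separation {T : Set V} (hne : T.Nonempty) (h : ¬ Conn G T) :
    ∃ A ⊆ T, A.Nonempty ∧ (T \ A).Nonempty ∧ ∀ a ∈ A, ∀ b ∈ T, G.Adj a b → b ∈ A := by
  by_contra hcon
  push Not at hcon
  refine h ⟨hne, fun A hA hAne hcl x hx => ?_⟩
  by_contra hxA
  obtain ⟨a, ha, b, hb, hab, hbA⟩ := hcon A hA hAne ⟨x, hx, hxA⟩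
  exact hbA (hcl a ha b hb hab)

/-- A part of `S` attached to the rest of `S` at a single vertex contains such a part none of
whose vertices is a cut vertex of `S`. -/
theorem exists_uncut_pendant [Finite V] {S : Set V} (hS : Conn G S) {C : Set V} {c : V}
    (hCS : C ⊆ S) (hC : C.Nonempty) (hcS : c ∈ S) (hcC : c ∉ C)
    (hcl : ∀ x ∈ C, ∀ y ∈ S, G.Adj x y → y ∈ C ∨ y = c) :
    ∃ X ⊆ C, X.Nonempty ∧ (∃ c' ∈ S, c' ∉ X ∧ ∀ x ∈ X, ∀ y ∈ S, G.Adj x y → y ∈ X ∨ y = c') ∧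
      ∀ x ∈ X, Conn G (S \ {x}) := by
  induction hn : C.ncard using Nat.strong_induction_on generalizing C c with
  | _ n ih =>
  by_cases hall : ∀ x ∈ C, Conn G (S \ {x})
  · exact ⟨C, subset_rfl, hC, ⟨c, hcS, hcC, hcl⟩, hall⟩
  push Not at hall
  obtain ⟨v, hvC, hv⟩ := hall
  have hcv : c ≠ v := fun h => hcC (h ▸ hvC)
  have key : ∀ X ⊆ S \ {v}, X.Nonempty → c ∉ X →
      (∀ a ∈ X, ∀ b ∈ S \ {v}, G.Adj a b → b ∈ X) →
      ∃ X ⊆ C, X.Nonempty ∧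
        (∃ c' ∈ S, c' ∉ X ∧ ∀ x ∈ X, ∀ y ∈ S, G.Adj x y → y ∈ X ∨ y = c') ∧
        ∀ x ∈ X, Conn G (S \ {x}) := by
    intro X hX hXne hcX hXcl
    have hvX : v ∉ X := fun h => (hX h).2 rfl
    have hXC : (X ∩ C).Nonempty := by
      by_contra hemp
      refine hvX (hS.2 X (fun x hx => (hX hx).1) hXne (fun a ha b hb hab => ?_) (hCS hvC))
      by_cases hbv : b = v
      · subst hbv
        rcases hcl b hvC a (hX ha).1 hab.symm with h | h
        · exact absurd ⟨a, ha, h⟩ hemp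
        · exact absurd (h ▸ ha) hcX
      · exact hXcl a ha b ⟨hb, hbv⟩ hab
    obtain ⟨Z, hZ, h1, h2, h3⟩ := ih (X ∩ C).ncard (by
        rw [← hn]
        exact Set.ncard_lt_ncard ⟨Set.inter_subset_right, fun h => hvX (h hvC).1⟩)
      (C := X ∩ C) (c := v) (fun x hx => hCS hx.2) hXC (hCS hvC) (fun h => hvX h.1) (by
        rintro x ⟨hxX, hxC⟩ y hy hxy
        by_cases hyv : y = v
        · exact Or.inr hyv
        · have hyX := hXcl x hxX y ⟨hy, hyv⟩ hxy
          rcases hcl x hxC y hy hxy with h | h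
          · exact Or.inl ⟨hyX, h⟩
          · exact absurd (h ▸ hyX) hcX) rfl
    exact ⟨Z, hZ.trans Set.inter_subset_right, h1, h2, h3⟩
  obtain ⟨A, hA, hAne, hBne, hAcl⟩ := exists_separation (T := S \ {v}) ⟨c, hcS, hcv⟩ hv
  by_cases hcA : c ∈ A
  · refine key ((S \ {v}) \ A) Set.sdiff_subset hBne (fun h => h.2 hcA) (fun a ha b hb hab => ?_)
    exact ⟨hb, fun hbA => ha.2 (hAcl b hbA a ha.1 hab.symm)⟩
  · exact key A hA hAne hcA hAcl

theorem Conn.exists_subset_ncard [Finite V] {S : Set V} (hS : Conn G S) {m : ℕ} (h1 : 1 ≤ m)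
    (hm : m ≤ S.ncard) : ∃ T ⊆ S, Conn G T ∧ T.ncard = m := by
  induction m, h1 using Nat.le_induction with
  | base =>
    obtain ⟨x, hx⟩ := hS.1
    exact ⟨{x}, by simpa using hx, conn_singleton x, Set.ncard_singleton x⟩
  | succ m h1 ih =>
    obtain ⟨T, hTS, hT, hTm⟩ := ih (by omega)
    obtain ⟨b, hbS, hbT⟩ := Set.exists_of_ssubset
      (hTS.ssubset_of_ne (fun h => by rw [h] at hTm; omega))
    obtain ⟨x, hx, y, hy, hyT, hxy⟩ := hS.exists_adj hTS hT.1 hbS hbT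
    exact ⟨insert y T, Set.insert_subset hy hTS, hT.insert hx hxy.symm, by
      rw [Set.ncard_insert_of_notMem hyT, hTm]⟩

/-- `X` is attached to the rest of `G` outside `F` by at most one vertex. -/
def IsPendant (G : SimpleGraph V) (F X : Set V) : Prop :=
  X.Nonempty ∧ ∃ c ∉ X, ∀ x ∈ X, ∀ y, G.Adj x y → y ∈ X ∨ y = c ∨ y ∈ F

theorem exists_adj_of_not_isPendant {F X : Set V} (hX : X.Nonempty) (h : ¬ IsPendant G F X) {c : V}
    (hc : c ∉ X) : ∃ x ∈ X, ∃ y, G.Adj x y ∧ y ∉ X ∧ y ≠ c ∧ y ∉ F := by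
  by_contra hcon
  push Not at hcon
  refine h ⟨hX, c, hc, fun x hx y hxy => ?_⟩
  by_cases hyX : y ∈ X
  · exact Or.inl hyX
  by_cases hyc : y = c
  · exact Or.inr (Or.inl hyc)
  exact Or.inr (Or.inr (hcon x hx y hxy hyX hyc))

theorem IsPendant.inter {F X T C : Set V} (hX : IsPendant G F X) (hXT : X ⊆ T)
    (hcl : ∀ a ∈ C, ∀ b ∈ T, G.Adj a b → b ∈ C) (hne : (X ∩ C).Nonempty) :
    IsPendant G F (X ∩ C) := by
  obtain ⟨_, c, hc, h⟩ := hX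
  refine ⟨hne, c, fun h => hc h.1, fun x hx y hxy => ?_⟩
  rcases h x hx.1 y hxy with h | h
  · exact Or.inl ⟨h, hcl x hx.2 y (hXT h) hxy⟩
  · exact Or.inr h

/-- A vertex on the boundary of a connected set lies in neither of two disjoint pendant sets
contained in it. -/
theorem notMem_pendant_of_adj {X Y D : Set V} (hX : IsPendant G ∅ X) (hY : IsPendant G ∅ Y)
    (hXY : Disjoint X Y) (hD : Conn G D) (hXD : X ⊆ D) (hYD : Y ⊆ D) {v w : V}
    (hw : w ∉ D) (hvw : G.Adj v w) : v ∉ X := by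
  obtain ⟨hne, c, hc, h⟩ := hX
  obtain ⟨y, hy⟩ := hY.1
  obtain ⟨x, hx, z, hz, hzX, hxz⟩ := hD.exists_adj hXD hne (hYD hy)
    (fun h => Set.disjoint_left.1 hXY h hy)
  have hzc : z = c := by
    rcases h x hx z hxz with h | h | h
    · exact absurd h hzX
    · exact h
    · exact absurd h (by simp)
  intro hv
  rcases h v hv w hvw with h | h | h
  · exact hw (hXD h)
  · exact hw (by rw [h, ← hzc]; exact hz)
  · exact absurd h (by simp)

end Connectivity

section Coloring

variable {V : Type u} {ι : Type*} {G : SimpleGraph V}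

/-- The class of label `a` under the labelling `f`. -/
abbrev fib (f : V → ι) (a : ι) : Set V := {x | f x = a}

/-- Every label class is connected (in particular nonempty). -/
def IsCol (G : SimpleGraph V) (f : V → ι) : Prop := ∀ a, Conn G (fib f a)

/-- `g` arises from `f` by giving a vertex `v` the label of a neighbour, where the old class of
`v` stays connected. -/
def Move (G : SimpleGraph V) (f g : V → ι) : Prop :=
  ∃ v w, G.Adj v w ∧ f v ≠ f w ∧ Conn G (fib f (f v) \ {v}) ∧ g v = f w ∧ ∀ x, x ≠ v → g x = f x

abbrev Reach (G : SimpleGraph V) : (V → ι) → (V → ι) → Prop := Relation.ReflTransGen (Move G)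

theorem fib_move_old {f g : V → ι} {v w : V} (h : f v ≠ f w) (hv : g v = f w)
    (hg : ∀ x, x ≠ v → g x = f x) : fib g (f v) = fib f (f v) \ {v} := by
  ext x
  by_cases hx : x = v
  · subst hx
    simp [hv, h.symm]
  · simp [hg x hx, hx]

theorem fib_move_new {f g : V → ι} {v w : V} (hv : g v = f w)
    (hg : ∀ x, x ≠ v → g x = f x) : fib g (f w) = insert v (fib f (f w)) := by
  ext x
  by_cases hx : x = v
  · subst hx
    simp [hv]
  · simp [hg x hx, hx]

theorem fib_move_other {f g : V → ι} {v w : V} (hv : g v = f w)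
    (hg : ∀ x, x ≠ v → g x = f x) {a : ι} (h1 : a ≠ f v) (h2 : a ≠ f w) :
    fib g a = fib f a := by
  ext x
  by_cases hx : x = v
  · subst hx
    simp [hv, h1.symm, h2.symm]
  · simp [hg x hx]

theorem Move.isCol {f g : V → ι} (hf : IsCol G f) (h : Move G f g) : IsCol G g := by
  obtain ⟨v, w, hvw, hne, hcon, hv, hg⟩ := h
  intro a
  by_cases h1 : a = f v
  · rw [h1, fib_move_old hne hv hg]
    exact hcon
  by_cases h2 : a = f w
  · rw [h2, fib_move_new hv hg]
    exact (hf _).insert rfl hvw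
  · rw [fib_move_other hv hg h1 h2]
    exact hf a

theorem Reach.isCol {f g : V → ι} (hf : IsCol G f) (h : Reach G f g) : IsCol G g := by
  induction h with
  | refl => exact hf
  | tail _ h ih => exact h.isCol ih

theorem exists_move_to {f : V → ι} {v w : V} (hvw : G.Adj v w) (hne : f v ≠ f w)
    (hcon : Conn G (fib f (f v) \ {v})) :
    ∃ g, Reach G f g ∧ g v = f w ∧ ∀ x, x ≠ v → g x = f x := by
  classical
  refine ⟨Function.update f v (f w), .single ⟨v, w, hvw, hne, hcon, ?_, ?_⟩, ?_, ?_⟩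
  · simp
  · intro x hx; simp [hx]
  · simp
  · intro x hx; simp [hx]

/-- A set missing a vertex of its class is small. -/
theorem IsCol.ncard_add_le [Finite V] {f : V → ι} (hf : IsCol G f) {X : Set V} {c : V}
    (hX : X ⊆ fib f (f c)) (hc : c ∉ X) : X.ncard + Nat.card ι ≤ Nat.card V := by
  classical
  choose t ht using fun a => (hf a).1
  let t' : ι → V := Function.update t (f c) c
  have ht' : ∀ a, f (t' a) = a := by
    intro a
    by_cases h : a = f c
    · subst h; simp [t']
    · simpa [t', h] using ht a
  have hinj : Function.Injective t' := fun a b h => by rw [← ht' a, h, ht' b]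
  have hdisj : Disjoint X (Set.range t') := by
    rw [Set.disjoint_left]
    rintro _ hx ⟨a, rfl⟩
    have : a = f c := by rw [← ht' a]; exact hX hx
    subst this
    exact hc (by simpa [t'] using hx)
  have h1 : (Set.range t').ncard = Nat.card ι := by
    rw [← Set.image_univ, Set.ncard_image_of_injective _ hinj, Set.ncard_univ]
  rw [← h1, ← Set.ncard_union_eq hdisj]
  exact Set.ncard_le_card _

theorem exists_uncut_move [Finite V] {f : V → ι} (hf : IsCol G f) {a : ι} {c : V} (hc : f c = a)
    {C : Set V} (hC : C ⊆ fib f a) (hne : C.Nonempty) (hcC : c ∉ C)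
    (hcl : ∀ x ∈ C, ∀ y, f y = a → G.Adj x y → y ∈ C ∨ y = c) {L : Set ι}
    (hL : ∀ X ⊆ C, X.Nonempty → ∀ c', f c' = a → c' ∉ X →
      ∃ x ∈ X, ∃ y, G.Adj x y ∧ y ∉ X ∧ y ≠ c' ∧ f y ∉ L) :
    ∃ x ∈ C, Conn G (fib f a \ {x}) ∧ ∃ y, G.Adj x y ∧ f y ≠ a ∧ f y ∉ L := by
  obtain ⟨X, hXC, hX, ⟨c', hc', hc'X, h⟩, hun⟩ := exists_uncut_pendant (hf a) hC hne hc hcC hcl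
  obtain ⟨x, hx, y, hxy, hyX, hyc, hyL⟩ := hL X hXC hX c' hc' hc'X
  refine ⟨x, hXC hx, hun x hx, y, hxy, fun hya => ?_, hyL⟩
  rcases h x hx y hya hxy with h | h
  · exact hyX h
  · exact hyc h

/-- A piece `C` of a class, attached to the rest of the class at the vertex `c`, can be
distributed among the other classes, avoiding the labels in `L`. -/
theorem dissolve [Finite V] {f : V → ι} (hf : IsCol G f) {a : ι} {c : V} (hc : f c = a)
    {C : Set V} (hC : C ⊆ fib f a) (hcC : c ∉ C)
    (hcl : ∀ x ∈ C, ∀ y, f y = a → G.Adj x y → y ∈ C ∨ y = c) {L : Set ι}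
    (hL : ∀ X ⊆ C, X.Nonempty → ∀ c', f c' = a → c' ∉ X →
      ∃ x ∈ X, ∃ y, G.Adj x y ∧ y ∉ X ∧ y ≠ c' ∧ f y ∉ L) :
    ∃ g, Reach G f g ∧ (∀ x, x ∉ C → g x = f x) ∧ ∀ x ∈ C, g x ≠ a ∧ g x ∉ L := by
  induction hn : C.ncard generalizing C f with
  | zero =>
    rw [Set.ncard_eq_zero] at hn
    subst hn
    exact ⟨f, .refl, fun _ _ => rfl, fun x hx => hx.elim⟩
  | succ n ih =>
    have hne : C.Nonempty := by
      rw [Set.nonempty_iff_ne_empty]; rintro rfl; simp at hn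
    obtain ⟨x, hx, hcon, y, hxy, hya, hyL⟩ := exists_uncut_move hf hc hC hne hcC hcl hL
    have hxa : f x = a := hC hx
    obtain ⟨f', hr, hf'x, hf'⟩ := exists_move_to (f := f) hxy (by rw [hxa]; exact hya.symm)
      (by rw [hxa]; exact hcon)
    have hcx : c ≠ x := fun h => hcC (h ▸ hx)
    have hback : ∀ z, f' z = a → f z = a := by
      intro z hz
      by_cases hzx : z = x
      · rw [hzx]; exact hxa
      · rw [← hf' z hzx]; exact hz
    have hne' : ∀ z, f' z = a → z ≠ x := by
      rintro z hz rfl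
      exact hya (hf'x ▸ hz)
    obtain ⟨g, hg, hg1, hg2⟩ := ih (hr.isCol hf) (C := C \ {x}) ((hf' c hcx).trans hc)
      (fun z hz => (hf' z hz.2).trans (hC hz.1)) (fun h => hcC h.1)
      (fun z hz w hw hzw => by
        rcases hcl z hz.1 w (hback w hw) hzw with h | h
        · exact Or.inl ⟨h, hne' w hw⟩
        · exact Or.inr h)
      (fun X hX hXne c' hc' hc'X => by
        obtain ⟨z, hz, w, hzw, hwX, hwc, hwL⟩ :=
          hL X (fun t ht => (hX ht).1) hXne c' (hback c' hc') hc'X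
        refine ⟨z, hz, w, hzw, hwX, hwc, ?_⟩
        by_cases hwx : w = x
        · rw [hwx, hf'x]; exact hyL
        · rw [hf' w hwx]; exact hwL)
      (by rw [Set.ncard_sdiff_singleton_of_mem hx, hn]; rfl)
    refine ⟨g, hr.trans hg, fun z hz => ?_, fun z hz => ?_⟩
    · rw [hg1 z (fun h => hz h.1), hf' z (fun h => hz (h ▸ hx))]
    · by_cases hzx : z = x
      · subst hzx
        rw [hg1 z (fun h => h.2 rfl), hf'x]
        exact ⟨hya, hyL⟩
      · exact hg2 z ⟨hz, hzx⟩

/-- Every vertex of `F` forms a class of its own. -/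
def Singles (f : V → ι) (F : Set V) : Prop := ∀ v ∈ F, ∀ x, f x = f v → x = v

theorem Singles.exists_adj {f : V → ι} {F X : Set V} (hF : Singles f F) (hX : X.Nonempty)
    (h : ¬ IsPendant G F X) {c : V} (hc : c ∉ X) :
    ∃ x ∈ X, ∃ y, G.Adj x y ∧ y ∉ X ∧ y ≠ c ∧ f y ∉ f '' F := by
  obtain ⟨x, hx, y, hxy, hyX, hyc, hyF⟩ := exists_adj_of_not_isPendant hX h hc
  refine ⟨x, hx, y, hxy, hyX, hyc, ?_⟩
  rintro ⟨v, hv, hvy⟩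
  exact hyF (by rw [hF v hv y hvy.symm]; exact hv)

theorem contract_class [Finite V] {f : V → ι} (hf : IsCol G f) {F : Set V} (hF : Singles f F)
    {r : V} (hr : r ∉ F) (hno : ∀ X ⊆ fib f (f r) \ {r}, ¬ IsPendant G F X) :
    ∃ g, Reach G f g ∧ Singles g (insert r F) := by
  obtain ⟨g, hg, hg1, hg2⟩ := dissolve hf (a := f r) (c := r) rfl (C := fib f (f r) \ {r})
    (L := f '' F) Set.sdiff_subset (fun h => h.2 rfl)
    (fun x _ y hy _ => (em (y = r)).symm.imp (fun h => ⟨hy, h⟩) id)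
    (fun X hX hXne c' _ hc' => hF.exists_adj hXne (hno X hX) hc')
  refine ⟨g, hg, ?_⟩
  have hrr : g r = f r := hg1 r (fun h => h.2 rfl)
  rintro v (rfl | hv) x hx
  · by_contra hxv
    have hxC : x ∉ fib f (f v) \ {v} := fun h => (hg2 x h).1 (hx.trans hrr)
    exact hxC ⟨by rw [Set.mem_ofPred_eq, ← hg1 x hxC, hx, hrr], hxv⟩
  · have hvC : v ∉ fib f (f r) \ {r} := fun h => hr (by rw [hF v hv r h.1.symm]; exact hv)
    rw [hg1 v hvC] at hx
    have hxC : x ∉ fib f (f r) \ {r} := fun h => (hg2 x h).2 ⟨v, hv, hx.symm⟩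
    exact hF v hv x (by rw [← hg1 x hxC, hx])

/-- A predicate on vertex sets such that no class contains two disjoint sets satisfying it,
although all pendant sets that fit properly into a class do. -/
structure IsAnchor (G : SimpleGraph V) (ι : Type*) (A : Set V → Prop) : Prop where
  not_disjoint : ∀ f : V → ι, IsCol G f → ∀ a, ∀ X ⊆ fib f a, ∀ Y ⊆ fib f a, A X → A Y →
    ¬ Disjoint X Y
  of_pendant : ∀ X, IsPendant G ∅ X → X.ncard + Nat.card ι ≤ Nat.card V → A X

/-- The predicate `A` also holds for the small pendant sets relative to `F` that avoid `r`. -/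
def AnchoredAt (G : SimpleGraph V) (ι : Type*) (A : Set V → Prop) (F : Set V) (r : V) : Prop :=
  ∀ X, Disjoint X F → r ∉ X → IsPendant G F X → X.ncard + Nat.card ι ≤ Nat.card V → A X

/-- A vertex `c` of a class that is not a singleton can be made non-cut in its class. -/
theorem exists_uncut_vertex [Finite V] {A : Set V → Prop} (hA : IsAnchor G ι A) {F : Set V}
    {r : V} (hAF : AnchoredAt G ι A F r) {f : V → ι} (hf : IsCol G f) (hF : Singles f F) {c d : V}
    (hcF : c ∉ F) (hdc : d ≠ c) (hd : f d = f c) (hr : f r ≠ f c) :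
    ∃ g, Reach G f g ∧ (∀ x, f x ≠ f c → g x = f x) ∧ g c = f c ∧
      Conn G (fib g (f c) \ {c}) ∧ Singles g F := by
  have hFc : ∀ v ∈ F, f v ≠ f c := fun v hv h => hcF (by rw [hF v hv c h.symm]; exact hv)
  obtain ⟨y, hyT, hy⟩ : ∃ y ∈ fib f (f c) \ {c}, ∀ X ⊆ fib f (f c) \ {c}, IsPendant G F X →
      ∃ Y ⊆ fib f (f c) \ {c}, IsPendant G F Y ∧ y ∈ Y := by
    by_cases h : ∃ Y ⊆ fib f (f c) \ {c}, IsPendant G F Y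
    · obtain ⟨Y, hY, hYp⟩ := h
      obtain ⟨y, hy⟩ := hYp.1
      exact ⟨y, hY hy, fun _ _ _ => ⟨Y, hY, hYp, hy⟩⟩
    · exact ⟨d, ⟨hd, hdc⟩, fun X hX hXp => absurd ⟨X, hX, hXp⟩ h⟩
  obtain ⟨C, hCT, hyC, hC, hCcl⟩ := exists_component G hyT
  have hanch : ∀ X ⊆ fib f (f c) \ {c}, IsPendant G F X → A X := fun X hX hXp =>
    hAF X (Set.disjoint_left.2 fun v hv hvF => hFc v hvF (hX hv).1) (fun h => hr (hX h).1) hXp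
      (hf.ncard_add_le (c := c) (fun x hx => (hX hx).1) (fun h => (hX h).2 rfl))
  obtain ⟨g, hg, hg1, hg2⟩ := dissolve hf (a := f c) (c := c) rfl
    (C := (fib f (f c) \ {c}) \ C) (L := f '' F) (fun x hx => hx.1.1) (fun h => h.1.2 rfl)
    (fun x hx y hy hxy => by
      by_cases hyc : y = c
      · exact Or.inr hyc
      · exact Or.inl ⟨⟨hy, hyc⟩, fun h => hx.2 (hCcl y h x hx.1 hxy.symm)⟩)
    (fun X hX hXne c' _ hc' => hF.exists_adj hXne (fun hXp => by
      have hXT : X ⊆ fib f (f c) \ {c} := fun x hx => (hX hx).1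
      obtain ⟨Y, hYT, hY, hyY⟩ := hy X hXT hXp
      have hYC := hY.inter hYT hCcl ⟨y, hyY, hyC⟩
      have hYCT : Y ∩ C ⊆ fib f (f c) \ {c} := fun x hx => hYT hx.1
      exact hA.not_disjoint f hf (f c) X (fun x hx => (hXT hx).1) (Y ∩ C)
        (fun x hx => (hYCT hx).1) (hanch X hXT hXp) (hanch _ hYCT hYC)
        (Set.disjoint_left.2 fun x hx hx' => (hX hx).2 hx'.2)) hc')
  refine ⟨g, hg, fun x hx => hg1 x (fun h => hx h.1.1), hg1 c (fun h => h.1.2 rfl), ?_, ?_⟩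
  · convert hC using 1
    ext x
    constructor
    · rintro ⟨hx, hxc⟩
      by_contra hxC
      have hx' : x ∉ (fib f (f c) \ {c}) \ C := fun h => (hg2 x h).1 hx
      exact hx' ⟨⟨by rw [Set.mem_ofPred_eq, ← hg1 x hx']; exact hx, hxc⟩, hxC⟩
    · intro hx
      exact ⟨(hg1 x (fun h => h.2 hx)).trans (hCT hx).1, (hCT hx).2⟩
  · intro v hv x hx
    have hvC : v ∉ (fib f (f c) \ {c}) \ C := fun h => hFc v hv h.1.1
    rw [hg1 v hvC] at hx
    have hxC : x ∉ (fib f (f c) \ {c}) \ C := fun h => (hg2 x h).2 ⟨v, hv, hx.symm⟩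
    exact hF v hv x (by rw [← hg1 x hxC, hx])

theorem exists_grow [Finite V] {A : Set V → Prop} (hA : IsAnchor G ι A) {F : Set V}
    (hFc : Conn G Fᶜ) {r : V} (hr : r ∉ F) (hAF : AnchoredAt G ι A F r) (a : ι) (z : V)
    (hz : z ∉ F) : ∀ f : V → ι, IsCol G f → Singles f F → f r = a → f z ≠ a →
      (∃ d, d ≠ z ∧ f d = f z) → ∃ g, Reach G f g ∧ fib f a ⊂ fib g a ∧ Singles g F := by
  refine (hFc.2 {z | z ∉ F ∧ ∀ f : V → ι, IsCol G f → Singles f F → f r = a → f z ≠ a →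
      (∃ d, d ≠ z ∧ f d = f z) → ∃ g, Reach G f g ∧ fib f a ⊂ fib g a ∧ Singles g F}
    (fun z hz => hz.1) ⟨r, hr, fun f _ _ h h' => absurd h h'⟩ ?_ hz).2
  rintro z ⟨hz, hgood⟩ z' hz' hzz'
  refine ⟨hz', fun f hf hF hra hz'a ⟨d, hd, hdz⟩ => ?_⟩
  by_cases hff : f z = f z'
  · exact hgood f hf hF hra (by rw [hff]; exact hz'a) ⟨z', hzz'.ne', hff.symm⟩
  obtain ⟨g, hfg, hg1, hg2, hg3, hgF⟩ :=
    exists_uncut_vertex hA hAF hf hF hz' hd hdz (by rw [hra]; exact hz'a.symm)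
  have hgz : g z = f z := hg1 z hff
  obtain ⟨g', hgg', hg'1, hg'2⟩ := exists_move_to (f := g) hzz'.symm
    (by rw [hg2, hgz]; exact Ne.symm hff) (by rw [hg2]; exact hg3)
  have hg'F : Singles g' F := by
    intro v hv x hx
    have hvz' : v ≠ z' := fun h => hz' (h ▸ hv)
    rw [hg'2 v hvz'] at hx
    by_cases hxz : x = z'
    · subst hxz
      rw [hg'1] at hx
      exact absurd (by rw [hgF v hv z hx]; exact hv) hz
    · rw [hg'2 x hxz] at hx
      exact hgF v hv x hx
  have hsub : fib f a ⊆ fib g' a := by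
    intro x hx
    have hx' : f x = a := hx
    have hxz : x ≠ z' := fun h => hz'a (h ▸ hx')
    change g' x = a
    rw [hg'2 x hxz, hg1 x (by rw [hx']; exact hz'a.symm), hx']
  have hreach : Reach G f g' := hfg.trans hgg'
  by_cases hza : f z = a
  · refine ⟨g', hreach, ⟨hsub, fun h => hz'a (h ?_)⟩, hg'F⟩
    change g' z' = a
    rw [hg'1, hgz, hza]
  · have hg'z : g' z = f z := (hg'2 z hzz'.ne).trans hgz
    obtain ⟨h, hh1, hh2, hh3⟩ := hgood g' (hreach.isCol hf) hg'F (hsub hra)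
      (by rw [hg'z]; exact hza) ⟨z', hzz'.ne', by rw [hg'1, hg'z, hgz]⟩
    exact ⟨h, hreach.trans hh1, hsub.trans_ssubset hh2, hh3⟩

/-- All classes except that of `r` can be made singletons. -/
theorem exists_concentrated [Finite V] {A : Set V → Prop} (hA : IsAnchor G ι A) {F : Set V}
    (hFc : Conn G Fᶜ) {r : V} (hr : r ∉ F) (hAF : AnchoredAt G ι A F r) {f : V → ι}
    (hf : IsCol G f) (hF : Singles f F) :
    ∃ g, Reach G f g ∧ Singles g F ∧ ∀ v w, g v ≠ g r → g w = g v → w = v := by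
  induction hn : Nat.card V - (fib f (f r)).ncard using Nat.strong_induction_on generalizing f with
  | _ n ih =>
  by_cases h : ∀ v w, f v ≠ f r → f w = f v → w = v
  · exact ⟨f, .refl, hF, h⟩
  push Not at h
  obtain ⟨v, w, hv, hwv, hne⟩ := h
  obtain ⟨g, hg, hsub, hgF⟩ := exists_grow hA hFc hr hAF (f r) v
    (fun h => hne (hF v h w hwv)) f hf hF rfl hv ⟨w, hne, hwv⟩
  have hgr : g r = f r := hsub.1 rfl
  have h1 := Set.ncard_lt_ncard hsub
  have h2 := Set.ncard_le_card (fib g (f r))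
  obtain ⟨g', hg', h⟩ := ih (Nat.card V - (fib g (g r)).ncard) (by rw [hgr]; omega)
    (hg.isCol hf) hgF rfl
  exact ⟨g', hg.trans hg', h⟩

end Coloring

section Absorption

variable {V : Type u} {ι : Type*} {G : SimpleGraph V}

/-- Move `r` to the label `b`, distributing the piece `Q` of its class. -/
theorem exists_transfer [Finite V] {r : V} {a b : ι} (hba : b ≠ a) {L : Set ι} (hbL : b ∉ L)
    {f : V → ι} (hf : IsCol G f) (hr : f r = a) {Q : Set V} (hQ : Q ⊆ fib f a) (hrQ : r ∉ Q)
    (hcl : ∀ x ∈ Q, ∀ y, f y = a → G.Adj x y → y ∈ Q ∨ y = r)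
    (hcon : Conn G ((fib f a \ {r}) \ Q))
    (hL : ∀ X ⊆ Q, X.Nonempty → ∀ c', f c' = a → c' ∉ X →
      ∃ x ∈ X, ∃ y, G.Adj x y ∧ y ∉ X ∧ y ≠ c' ∧ f y ∉ L)
    {u w : V} (hu : u = r ∨ u ∈ Q) (huw : G.Adj u w) (hw : f w = b) :
    ∃ g, Reach G f g ∧ g r = b ∧ (∀ x, x ≠ r → x ∉ Q → g x = f x) ∧
      ∀ x ∈ Q, g x ≠ a ∧ g x ∉ L := by
  induction hn : Q.ncard generalizing Q f u w with
  | zero =>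
    rw [Set.ncard_eq_zero] at hn
    subst hn
    have hur : u = r := hu.resolve_right (fun h => h)
    subst hur
    obtain ⟨g, hg, hg1, hg2⟩ := exists_move_to (f := f) huw (by rw [hr, hw]; exact hba.symm)
      (by rw [hr]; simpa using hcon)
    exact ⟨g, hg, hg1.trans hw, fun x hx _ => hg2 x hx, fun x hx => hx.elim⟩
  | succ n ih =>
    have hne : Q.Nonempty := by
      rw [Set.nonempty_iff_ne_empty]; rintro rfl; simp at hn
    obtain ⟨v, hv, hvcon, y, hvy, hya, hyL⟩ := exists_uncut_move hf hr hQ hne hrQ hcl hL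
    have hva : f v = a := hQ hv
    have hrv : r ≠ v := fun h => hrQ (h ▸ hv)
    obtain ⟨y', u', w', hvy', hy'a, hy'L, hu', hu'w', hw'⟩ : ∃ y' u' w', G.Adj v y' ∧ f y' ≠ a ∧
        f y' ∉ L ∧ (u' = r ∨ u' ∈ Q \ {v}) ∧ G.Adj u' w' ∧
        ((w' = v ∧ f y' = b) ∨ (w' ≠ v ∧ f w' = b)) := by
      by_cases huv : u = v
      · subst huv
        obtain ⟨x, hx, z, hz, hzx, hxz⟩ := (hf a).exists_adj (A := {u}) (b := r)
          (by simpa using hva) ⟨u, rfl⟩ hr hrv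
        obtain rfl : x = u := hx
        exact ⟨w, z, x, huw, by rw [hw]; exact hba, by rw [hw]; exact hbL,
          (hcl x hv z hz hxz).symm.imp id (fun h => ⟨h, hzx⟩), hxz.symm, Or.inl ⟨rfl, hw⟩⟩
      · exact ⟨y, u, w, hvy, hya, hyL, hu.imp id (fun h => ⟨h, huv⟩), huw,
          Or.inr ⟨fun h => hba (by rw [← hw, h, hva]), hw⟩⟩
    obtain ⟨f', hf', hf'1, hf'2⟩ := exists_move_to (f := f) hvy' (by rw [hva]; exact hy'a.symm)
      (by rw [hva]; exact hvcon)
    have hback : ∀ z, f' z = a → f z = a ∧ z ≠ v := by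
      intro z hz
      by_cases hzv : z = v
      · subst hzv
        exact absurd (hf'1 ▸ hz) hy'a
      · exact ⟨by rw [← hf'2 z hzv]; exact hz, hzv⟩
    obtain ⟨g, hg, hg1, hg2, hg3⟩ := ih (hf'.isCol hf) (Q := Q \ {v}) ((hf'2 r hrv).trans hr)
      (fun z hz => (hf'2 z hz.2).trans (hQ hz.1)) (fun h => hrQ h.1)
      (fun z hz t ht hzt =>
        (hcl z hz.1 t (hback t ht).1 hzt).imp (fun h => ⟨h, (hback t ht).2⟩) id)
      (by
        convert hcon using 1
        ext z
        constructor
        · rintro ⟨⟨hz, hzr⟩, hzQ⟩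
          exact ⟨⟨(hback z hz).1, hzr⟩, fun h => hzQ ⟨h, (hback z hz).2⟩⟩
        · rintro ⟨⟨hz, hzr⟩, hzQ⟩
          exact ⟨⟨(hf'2 z (fun h => hzQ (h ▸ hv))).trans hz, hzr⟩, fun h => hzQ h.1⟩)
      (fun X hX hXne c' hc' hc'X => by
        obtain ⟨x, hx, t, hxt, htX, htc, htL⟩ :=
          hL X (fun z hz => (hX hz).1) hXne c' (hback c' hc').1 hc'X
        refine ⟨x, hx, t, hxt, htX, htc, ?_⟩
        by_cases htv : t = v
        · rw [htv, hf'1]; exact hy'L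
        · rw [hf'2 t htv]; exact htL)
      hu' hu'w' (by
        rcases hw' with ⟨rfl, h⟩ | ⟨h, h'⟩
        · exact hf'1.trans h
        · exact (hf'2 w' h).trans h')
      (by rw [Set.ncard_sdiff_singleton_of_mem hv, hn]; rfl)
    refine ⟨g, hf'.trans hg, hg1, fun x hxr hxQ => ?_, fun x hx => ?_⟩
    · rw [hg2 x hxr (fun h => hxQ h.1), hf'2 x (fun h => hxQ (h ▸ hv))]
    · by_cases hxv : x = v
      · subst hxv
        rw [hg2 x hrv.symm (fun h => h.2 rfl), hf'1]
        exact ⟨hy'a, hy'L⟩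
      · exact hg3 x ⟨hx, hxv⟩

/-- Vertices of `E` carrying labels of `F` can be given labels used neither by `F` nor by the
class `a`, provided that `E` is not adjacent to the latter and contains no pendant set. -/
theorem exists_reabsorb [Finite V] {F E : Set V} {a : ι} (hFc : Conn G Fᶜ) (hEF : Disjoint E F)
    (hE : ∀ X ⊆ E, ¬ IsPendant G ∅ X) {f : V → ι} (hf : IsCol G f) (haF : ∀ v ∈ F, f v ≠ a)
    (hinj : ∀ v ∈ F, ∀ x ∈ F, f x = f v → x = v)
    (hFE : ∀ v ∈ F, ∀ x, f x = f v → x ∈ F ∨ x ∈ E) (haE : ∀ x ∈ E, f x ≠ a)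
    (hadj : ∀ x ∈ E, ∀ y, G.Adj x y → f y ≠ a) :
    ∃ g, Reach G f g ∧ (∀ x, x ∉ E → g x = f x) ∧ ∀ x ∈ E, g x ≠ a ∧ ∀ v ∈ F, g x ≠ f v := by
  induction hn : {x ∈ E | f x ∈ f '' F}.ncard using Nat.strong_induction_on generalizing f with
  | _ n ih =>
  by_cases hU : {x ∈ E | f x ∈ f '' F}.Nonempty
  swap
  · refine ⟨f, .refl, fun _ _ => rfl, fun x hx => ⟨haE x hx, fun v hv h => hU ⟨x, hx, v, hv, h.symm⟩⟩⟩
  obtain ⟨b, hb⟩ := (hf a).1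
  have hEF' : ∀ x ∈ E, x ∉ F := fun x hx h => Set.disjoint_left.1 hEF hx h
  obtain ⟨u, ⟨huE, φ, hφ, hφu⟩, w, hwF, hwU, huw⟩ := hFc.exists_adj (b := b)
    (fun x hx => hEF' x hx.1) hU (fun h => haF b h hb)
    (by rintro ⟨-, v, hv, h⟩; exact haF v hv (h.trans hb))
  have hwL : ∀ v ∈ F, f w ≠ f v := fun v hv h =>
    hwU ⟨(hFE v hv w h).resolve_left hwF, v, hv, h.symm⟩
  have huφ : φ ≠ u := fun h => hEF' u huE (h ▸ hφ)
  obtain ⟨C, hCT, hφC, hC, hCcl⟩ := exists_component G (T := fib f (f u) \ {u}) ⟨hφu, huφ⟩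
  have hRE : (fib f (f u) \ {u}) \ C ⊆ E := by
    rintro x ⟨⟨hx, hxu⟩, hxC⟩
    rcases hFE φ hφ x (hx.trans hφu.symm) with h | h
    · exact absurd (by rw [hinj φ hφ x h (hx.trans hφu.symm)]; exact hφC) hxC
    · exact h
  obtain ⟨g, hg, hg1, hg2⟩ := dissolve hf (a := f u) (c := u) rfl
    (C := (fib f (f u) \ {u}) \ C) (L := {a}) (fun x hx => hx.1.1) (fun h => h.1.2 rfl)
    (fun x hx y hy hxy => by
      by_cases hyu : y = u
      · exact Or.inr hyu
      · exact Or.inl ⟨⟨hy, hyu⟩, fun h => hx.2 (hCcl y h x hx.1 hxy.symm)⟩)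
    (fun X hX hXne c' _ hc' => by
      obtain ⟨x, hx, y, hxy, hyX, hyc, -⟩ :=
        exists_adj_of_not_isPendant hXne (hE X (hX.trans hRE)) hc'
      exact ⟨x, hx, y, hxy, hyX, hyc, hadj x (hRE (hX hx)) y hxy⟩)
  have hgu : g u = f u := hg1 u (fun h => h.1.2 rfl)
  have hgw : g w = f w := hg1 w (fun h => hwL φ hφ (by rw [hφu]; exact h.1.1))
  have hfib : fib g (f u) \ {u} = C := by
    ext x
    constructor
    · rintro ⟨hx, hxu⟩
      by_contra hxC
      have hx' : x ∉ (fib f (f u) \ {u}) \ C := fun h => (hg2 x h).1 hx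
      exact hx' ⟨⟨by rw [Set.mem_ofPred_eq, ← hg1 x hx']; exact hx, hxu⟩, hxC⟩
    · intro hx
      exact ⟨(hg1 x (fun h => h.2 hx)).trans (hCT hx).1, (hCT hx).2⟩
  obtain ⟨f', hf', hf'1, hf'2⟩ := exists_move_to (f := g) huw
    (by rw [hgu, hgw]; exact fun h => hwL φ hφ (by rw [hφu, h])) (by rw [hgu, hfib]; exact hC)
  have hreach : Reach G f f' := hg.trans hf'
  have hoff : ∀ x, x ∉ E → f' x = f x := fun x hx => by
    rw [hf'2 x (fun h => hx (h ▸ huE)), hg1 x (fun h => hx (hRE h))]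
  have hoffF : ∀ v ∈ F, f' v = f v := fun v hv => hoff v (fun h => hEF' v h hv)
  have hf'u : f' u = f w := hf'1.trans hgw
  have haE' : ∀ x ∈ E, f' x ≠ a := by
    intro x hx
    by_cases hxu : x = u
    · rw [hxu, hf'u]; exact hadj u huE w huw
    rw [hf'2 x hxu]
    by_cases hxC : x ∈ (fib f (f u) \ {u}) \ C
    · exact (hg2 x hxC).2
    · rw [hg1 x hxC]; exact haE x hx
  obtain ⟨h, hh, hh1, hh2⟩ := ih {x ∈ E | f' x ∈ f' '' F}.ncard
    (by
      rw [← hn]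
      refine Set.ncard_lt_ncard ⟨?_, fun hsub => ?_⟩
      · rintro x ⟨hx, v, hv, hvx⟩
        refine ⟨hx, ?_⟩
        rw [hoffF v hv] at hvx
        by_cases hxu : x = u
        · exact hxu ▸ ⟨φ, hφ, hφu⟩
        by_cases hxC : x ∈ (fib f (f u) \ {u}) \ C
        · exact ⟨φ, hφ, by rw [hφu]; exact hxC.1.1.symm⟩
        · exact ⟨v, hv, by rw [hvx, hf'2 x hxu, hg1 x hxC]⟩
      · obtain ⟨-, v, hv, hvu⟩ := hsub ⟨huE, φ, hφ, hφu⟩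
        exact hwL v hv (by rw [← hf'u, ← hvu, hoffF v hv]))
    (hreach.isCol hf) (fun v hv => by rw [hoffF v hv]; exact haF v hv)
    (fun v hv x hx h => hinj v hv x hx (by rw [← hoffF v hv, ← hoffF x hx, h]))
    (fun v hv x h => by
      by_cases hxE : x ∈ E
      · exact Or.inr hxE
      · exact hFE v hv x (by rw [← hoff x hxE, ← hoffF v hv, h]))
    haE' (fun x hx y hxy => by
      by_cases hyE : y ∈ E
      · exact haE' y hyE
      · rw [hoff y hyE]; exact hadj x hx y hxy) rfl
  refine ⟨h, hreach.trans hh, fun x hx => (hh1 x hx).trans (hoff x hx), fun x hx => ?_⟩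
  exact ⟨(hh2 x hx).1, fun v hv => by rw [← hoffF v hv]; exact (hh2 x hx).2 v hv⟩

end Absorption

section Isolation

variable {V : Type u} {ι : Type*} {G : SimpleGraph V}

/-- The class of `r` in `f` can be contracted to `r` once the class `D` of `r` in `f₀`, all of
whose other classes are singletons, has been split suitably. -/
theorem exists_isolated_of_split [Finite V] {A : Set V → Prop} (hA : IsAnchor G ι A) {F : Set V}
    {r : V} (hr : r ∉ F) (hAF : AnchoredAt G ι A F r) (hFr : Conn G (insert r F)ᶜ) {f₀ : V → ι}
    (hf₀ : IsCol G f₀) (hF₀ : Singles f₀ F) (hinj : ∀ v w, f₀ v ≠ f₀ r → f₀ w = f₀ v → w = v)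
    {f : V → ι} (hf : IsCol G f) (hoff : ∀ x, f₀ x ≠ f₀ r → f x = f₀ x)
    (hlab : ∀ x, f₀ x = f₀ r → ∀ v ∈ F, f x ≠ f₀ v) (hfr : f r ≠ f₀ r) {Y : Set V}
    (hY : Y ⊆ fib f (f₀ r)) (hAY : A Y)
    (hz : ∀ z, f₀ z ≠ f₀ r → f₀ z = f r → Conn G (fib f₀ (f₀ r) \ {r}) ∨
      ∃ g, g ∉ F ∧ G.Adj z g ∧ f g ≠ f r) :
    ∃ g, Reach G f g ∧ Singles g (insert r F) := by
  have hFa : ∀ v ∈ F, f₀ v ≠ f₀ r := fun v hv h => hr (by rw [hF₀ v hv r h.symm]; exact hv)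
  have hF : Singles f F := by
    intro v hv x hx
    rw [hoff v (hFa v hv)] at hx
    by_cases hxa : f₀ x = f₀ r
    · exact absurd hx (hlab x hxa v hv)
    · exact hF₀ v hv x (by rw [← hoff x hxa, hx])
  refine contract_class hf hF hr fun X hX hXp => ?_
  have hrX : r ∉ X := fun h => (hX h).2 rfl
  have hXF : Disjoint X F := Set.disjoint_left.2 fun v hv hvF => hr (by
    rw [hF v hvF r (hX hv).1.symm]; exact hvF)
  have hAX : A X := hAF X hXF hrX hXp (hf.ncard_add_le (c := r) (fun x hx => (hX hx).1) hrX)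
  have hYD : Y ⊆ fib f₀ (f₀ r) := by
    intro y hy
    by_contra hya
    exact hya ((hoff y hya).symm.trans (hY hy))
  have hXY : Disjoint X Y := Set.disjoint_left.2 fun x hx hxY =>
    hfr ((hX hx).1.symm.trans (hY hxY))
  by_cases hXD : X ⊆ fib f₀ (f₀ r)
  · exact hA.not_disjoint f₀ hf₀ _ X hXD Y hYD hAX hAY hXY
  obtain ⟨z, hzX, hzD⟩ := Set.not_subset.1 hXD
  have hza : f₀ z ≠ f₀ r := hzD
  have hfz : f z = f r := (hX hzX).1
  have hf₀z : f₀ z = f r := (hoff z hzD).symm.trans hfz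
  have hzF : z ∉ F := fun h => Set.disjoint_left.1 hXF hzX h
  obtain ⟨hne, c, hcX, hc⟩ := hXp
  have hcf : f c = f r := by
    obtain ⟨x, hx, y, hy, hyX, hxy⟩ := (hf (f r)).exists_adj (A := X) (b := r)
      (fun x hx => (hX hx).1) hne rfl hrX
    rcases hc x hx y hxy with h | h | h
    · exact absurd h hyX
    · exact h ▸ hy
    · exact absurd (by rw [hF y h r (show f r = f y from Eq.symm hy)]; exact h) hr
  have hnbr : ∀ g, g ∉ F → G.Adj z g → f g = f r := by
    intro g hg hzg
    rcases hc z hzX g hzg with h | h | h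
    · exact (hX h).1
    · exact h ▸ hcf
    · exact absurd h hg
  rcases hz z hzD hf₀z with hcon | ⟨g, hgF, hzg, hg⟩
  swap
  · exact hg (hnbr g hgF hzg)
  have hzr : z ≠ r := fun h => hrX (h ▸ hzX)
  obtain ⟨d, hd, hdr⟩ := hcon.1
  obtain ⟨z', hz', g, hg, -, hzg⟩ := hFr.exists_adj (A := {z}) (b := d)
    (by rintro _ rfl; simp [hzr, hzF]) ⟨z, rfl⟩
    (by
      rintro (h | h)
      · exact hdr h
      · exact hFa d h hd)
    (by rintro rfl; exact hzD hd)
  rw [show z' = z from hz'] at hzg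
  have hgr : g ≠ r := fun h => hg (Or.inl h)
  have hgF : g ∉ F := fun h => hg (Or.inr h)
  have hgD : f₀ g = f₀ r := by
    by_contra h
    exact hzg.ne (hinj g z h (by rw [hf₀z, ← hnbr g hgF hzg, hoff g h]))
  classical
  let f₁ : V → ι := Function.update (Function.update f₀ r (f₀ z)) z (f₀ r)
  have hf₁z : f₁ z = f₀ r := by simp [f₁]
  have hf₁r : f₁ r = f₀ z := by simp [f₁, hzr.symm]
  have hf₁ : ∀ x, x ≠ r → x ≠ z → f₁ x = f₀ x := fun x h h' => by simp [f₁, h, h']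
  have hfib : fib f₁ (f₀ r) = insert z (fib f₀ (f₀ r) \ {r}) := by
    ext x
    by_cases hxz : x = z
    · subst hxz; simp [hf₁z]
    by_cases hxr : x = r
    · subst hxr; simp [hf₁r, hza, hxz]
    simp [hf₁ x hxr hxz, hxz, hxr]
  have hcol : IsCol G f₁ := by
    intro b
    by_cases h1 : b = f₀ r
    · rw [h1, hfib]
      exact hcon.insert ⟨hgD, hgr⟩ hzg
    by_cases h2 : b = f₀ z
    · convert conn_singleton (G := G) r using 1
      ext x
      by_cases hxr : x = r
      · subst hxr; simp [hf₁r, h2]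
      by_cases hxz : x = z
      · subst hxz; simp [hf₁z, Ne.symm h1, hzr]
      · simp only [Set.mem_ofPred_eq, hf₁ x hxr hxz, h2, Set.mem_singleton_iff, hxr, iff_false]
        exact fun h => hxz (hinj z x hzD h)
    · convert hf₀ b using 1
      ext x
      by_cases hxr : x = r
      · subst hxr; simp [hf₁r, Ne.symm h2, Ne.symm h1]
      by_cases hxz : x = z
      · subst hxz; simp [hf₁z, Ne.symm h2, Ne.symm h1]
      · simp [hf₁ x hxr hxz]
  refine hA.not_disjoint f₁ hcol (f₀ r) X ?_ Y ?_ hAX hAY hXY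
  · rw [hfib]
    intro x hx
    by_cases hxD : f₀ x = f₀ r
    · exact Or.inr ⟨hxD, (hX hx).2⟩
    · exact Or.inl (hinj z x hzD (by rw [← hoff x hxD, (hX hx).1, hf₀z]))
  · rw [hfib]
    intro y hy
    exact Or.inr ⟨hYD hy, fun h => hfr ((congrArg f h).symm.trans (hY hy))⟩

theorem exists_isolated_of_cut [Finite V] {A : Set V → Prop} (hA : IsAnchor G ι A) {F : Set V}
    {r : V} (hr : r ∉ F) (hAF : AnchoredAt G ι A F r) (hFr : Conn G (insert r F)ᶜ) {f : V → ι}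
    (hf : IsCol G f) (hF : Singles f F) (hinj : ∀ v w, f v ≠ f r → f w = f v → w = v)
    (hcut : ¬ Conn G (fib f (f r) \ {r})) :
    ∃ g, Reach G f g ∧ Singles g (insert r F) := by
  by_cases hno : ∀ X ⊆ fib f (f r) \ {r}, ¬ IsPendant G F X
  · exact contract_class hf hF hr hno
  push Not at hno
  obtain ⟨Y, hY, hYp⟩ := hno
  obtain ⟨y, hy⟩ := hYp.1
  obtain ⟨C, hCT, hyC, hC, hCcl⟩ := exists_component G (hY hy)
  have hFa : ∀ v ∈ F, f v ≠ f r := fun v hv h => hr (by rw [hF v hv r h.symm]; exact hv)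
  have hanch : ∀ X ⊆ fib f (f r) \ {r}, IsPendant G F X → A X := fun X hX hXp =>
    hAF X (Set.disjoint_left.2 fun v hv hvF => hFa v hvF (hX hv).1) (fun h => (hX h).2 rfl) hXp
      (hf.ncard_add_le (c := r) (fun x hx => (hX hx).1) (fun h => (hX h).2 rfl))
  have hAY : A (Y ∩ C) := hanch _ (fun x hx => hY hx.1) (hYp.inter hY hCcl ⟨y, hy, hyC⟩)
  let Q := (fib f (f r) \ {r}) \ C
  have hQne : Q.Nonempty := by
    by_contra h
    rw [Set.not_nonempty_iff_eq_empty, Set.sdiff_eq_empty] at h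
    exact hcut (by rw [← hCT.antisymm h] ; exact hC)
  have hQcl : ∀ x ∈ Q, ∀ y, f y = f r → G.Adj x y → y ∈ Q ∨ y = r := by
    intro x hx y hy hxy
    by_cases hyr : y = r
    · exact Or.inr hyr
    · exact Or.inl ⟨⟨hy, hyr⟩, fun h => hx.2 (hCcl y h x hx.1 hxy.symm)⟩
  have hQp : ∀ X ⊆ Q, ¬ IsPendant G F X := fun X hX hXp =>
    hA.not_disjoint f hf (f r) X (fun x hx => (hX hx).1.1) (Y ∩ C) (fun x hx => (hY hx.1).1)
      (hanch X (fun x hx => (hX hx).1) hXp) hAY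
      (Set.disjoint_left.2 fun x hx hx' => (hX hx).2 hx'.2)
  obtain ⟨p, u, g, hpF, hpa, huQ, hup, hgF, hgr, hgQ, hpg⟩ : ∃ p u g, p ∉ F ∧ f p ≠ f r ∧ u ∈ Q ∧
      G.Adj u p ∧ g ∉ F ∧ g ≠ r ∧ g ∉ Q ∧ G.Adj p g := by
    obtain ⟨x, hx, g, hg, hgZ, hxg⟩ := hFr.exists_adj (b := y)
      (A := Q ∪ {p | p ∉ F ∧ f p ≠ f r ∧ ∃ u ∈ Q, G.Adj u p})
      (by
        rintro x (hx | ⟨hxF, hxa, -⟩) (h | h)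
        · exact hx.1.2 h
        · exact hFa x h hx.1.1
        · exact hxa (congrArg f h)
        · exact hxF h)
      (hQne.mono Set.subset_union_left)
      (by
        rintro (h | h)
        · exact (hY hy).2 h
        · exact hFa y h (hY hy).1)
      (by
        rintro (h | h)
        · exact h.2 hyC
        · exact h.2.1 (hY hy).1)
    have hgr : g ≠ r := fun h => hg (Or.inl h)
    have hgF : g ∉ F := fun h => hg (Or.inr h)
    have hgQ : g ∉ Q := fun h => hgZ (Or.inl h)
    rcases hx with hx | ⟨hxF, hxa, u, hu, hux⟩
    · refine absurd (Or.inr ⟨hgF, fun h => ?_, x, hx, hxg⟩) hgZ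
      rcases hQcl x hx g h hxg with h | h
      · exact hgQ h
      · exact hgr h
    · exact ⟨x, u, g, hxF, hxa, hu, hux, hgF, hgr, hgQ, hxg⟩
  have hpL : f p ∉ f '' F := by
    rintro ⟨v, hv, hvp⟩
    exact hpF (by rw [hF v hv p hvp.symm]; exact hv)
  obtain ⟨h, hh, hh1, hh2, hh3⟩ := exists_transfer hpa hpL hf rfl (Q := Q) (fun x hx => hx.1.1)
    (fun h => h.1.2 rfl) hQcl (by
      convert hC using 1
      exact sdiff_sdiff_eq_self hCT)
    (fun X hX hXne c' _ hc' => hF.exists_adj hXne (hQp X hX) hc') (Or.inr huQ) hup rfl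
  obtain ⟨g', hg', hg'F⟩ := exists_isolated_of_split hA hr hAF hFr hf hF hinj (hh.isCol hf)
    (fun x hx => hh2 x (fun h => hx (congrArg f h)) (fun h => hx h.1.1))
    (fun x hx v hv => by
      by_cases hxr : x = r
      · rw [hxr, hh1]
        exact fun h => hpL ⟨v, hv, h.symm⟩
      by_cases hxQ : x ∈ Q
      · exact fun h => (hh3 x hxQ).2 ⟨v, hv, h.symm⟩
      · rw [hh2 x hxr hxQ, hx]
        exact (hFa v hv).symm)
    (by rw [hh1]; exact hpa) (Y := Y ∩ C)
    (fun x hx => (hh2 x (hY hx.1).2 (fun h => h.2 hx.2)).trans (hY hx.1).1) hAY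
    (fun z hz hzr => by
      have hzp : p = z := hinj z p hz (by rw [hzr, hh1])
      subst hzp
      refine Or.inr ⟨g, hgF, hpg, ?_⟩
      rw [hh2 g hgr hgQ, hh1]
      exact fun h => hpg.ne (hinj p g hz h).symm)
  exact ⟨g', hh.trans hg', hg'F⟩

theorem exists_isolated_of_not_cut [Finite V] {A : Set V → Prop} (hA : IsAnchor G ι A) {F : Set V}
    (hFc : Conn G Fᶜ) {r : V} (hr : r ∉ F) (hAF : AnchoredAt G ι A F r)
    (hFr : Conn G (insert r F)ᶜ) {f₀ : V → ι} (hf₀ : IsCol G f₀) (hF₀ : Singles f₀ F)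
    (hinj : ∀ v w, f₀ v ≠ f₀ r → f₀ w = f₀ v → w = v) (hcon : Conn G (fib f₀ (f₀ r) \ {r}))
    {q : V} (hqF : q ∉ F) (hq : f₀ q ≠ f₀ r) {f : V → ι} (hf : IsCol G f)
    (hoff : ∀ x, f₀ x ≠ f₀ r → f x = f₀ x) (hlab : ∀ x, f₀ x = f₀ r → ∀ v ∈ F, f x ≠ f₀ v)
    (hfr : f r = f₀ r) :
    ∃ g, Reach G f g ∧ Singles g (insert r F) := by
  induction hn : (fib f (f r)).ncard using Nat.strong_induction_on generalizing f with
  | _ n ih =>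
  have hFa : ∀ v ∈ F, f₀ v ≠ f₀ r := fun v hv h => hr (by rw [hF₀ v hv r h.symm]; exact hv)
  have hF : Singles f F := by
    intro v hv x hx
    rw [hoff v (hFa v hv)] at hx
    by_cases hxa : f₀ x = f₀ r
    · exact absurd hx (hlab x hxa v hv)
    · exact hF₀ v hv x (by rw [← hoff x hxa, hx])
  by_cases hno : ∀ X ⊆ fib f (f r) \ {r}, ¬ IsPendant G F X
  · exact contract_class hf hF hr hno
  push Not at hno
  obtain ⟨Y₀, hY₀, hY₀p⟩ := hno
  have hsD : fib f (f r) ⊆ fib f₀ (f₀ r) := by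
    intro x hx
    by_contra hxa
    exact hxa ((hoff x hxa).symm.trans (hx.trans hfr))
  have hFs : ∀ v ∈ F, f v ≠ f r := fun v hv h => hFa v hv (hsD h)
  have hLF : ∀ x, x ∉ F → f x ∉ f '' F := by
    rintro x hx ⟨v, hv, hvx⟩
    exact hx (by rw [hF v hv x hvx.symm]; exact hv)
  by_cases hmove : ∃ v ∈ fib f (f r), v ≠ r ∧ Conn G (fib f (f r) \ {v}) ∧
      ∃ y, G.Adj v y ∧ f y ≠ f r ∧ y ∉ F
  · obtain ⟨v, hv, hvr, hvc, y, hvy, hya, hyF⟩ := hmove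
    have hv' : f v = f r := hv
    obtain ⟨f', hf', hf'1, hf'2⟩ := exists_move_to (f := f) hvy (by rw [hv']; exact hya.symm)
      (by rw [hv']; exact hvc)
    have hrr : f' r = f r := hf'2 r hvr.symm
    obtain ⟨g, hg, hgF⟩ := ih (fib f' (f' r)).ncard
      (by
        rw [← hn, hrr, ← hv', fib_move_old (by rw [hv']; exact hya.symm) hf'1 hf'2]
        exact Set.ncard_sdiff_singleton_lt_of_mem rfl)
      (hf'.isCol hf)
      (fun x hx => by
        rw [hf'2 x (fun h => hx (hsD (h ▸ hv))), hoff x hx])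
      (fun x hx w hw => by
        by_cases hxv : x = v
        · rw [hxv, hf'1, ← hoff w (hFa w hw)]
          exact fun h => hLF y hyF ⟨w, hw, h.symm⟩
        · rw [hf'2 x hxv]
          exact hlab x hx w hw)
      (hrr.trans hfr) rfl
    exact ⟨g, hf'.trans hg, hgF⟩
  push Not at hmove
  obtain ⟨c, hc, p, hp, hpA, hcp⟩ := hFr.exists_adj (A := fib f (f r) \ {r}) (b := q)
    (by
      rintro x ⟨hx, hxr⟩ (h | h)
      · exact hxr h
      · exact hFs x h hx)
    (hY₀p.1.mono hY₀)
    (by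
      rintro (h | h)
      · exact hq (congrArg f₀ h)
      · exact hqF h)
    (fun h => hq (hsD h.1))
  obtain ⟨hcs, hcr⟩ := hc
  have hca : f c = f r := hcs
  have hcr' : c ≠ r := hcr
  have hpF : p ∉ F := fun h => hp (Or.inr h)
  have hpa : f p ≠ f r := fun h => hpA ⟨h, fun h => hp (Or.inl h)⟩
  have hcut : ¬ Conn G (fib f (f r) \ {c}) := fun h => hpF (hmove c hcs hcr' h p hcp hpa)
  obtain ⟨E, hET, hrE, hE, hEcl⟩ := exists_component G (T := fib f (f r) \ {c}) (y := r)
    ⟨rfl, hcr'.symm⟩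
  have hC₂ne : ((fib f (f r) \ {c}) \ E).Nonempty := by
    by_contra h
    rw [Set.not_nonempty_iff_eq_empty, Set.sdiff_eq_empty] at h
    exact hcut (by rw [← hET.antisymm h]; exact hE)
  obtain ⟨Y₁, hY₁, hY₁p⟩ : ∃ Y ⊆ (fib f (f r) \ {c}) \ E, IsPendant G F Y := by
    by_contra hcon'
    push Not at hcon'
    obtain ⟨x, hx, hxc, y, hxy, hya, hyL⟩ := exists_uncut_move hf hca
      (C := (fib f (f r) \ {c}) \ E) (L := f '' F) (fun x hx => hx.1.1) hC₂ne
      (fun h => h.1.2 rfl)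
      (fun x hx y hy hxy => by
        by_cases hyc : y = c
        · exact Or.inr hyc
        · exact Or.inl ⟨⟨hy, hyc⟩, fun h => hx.2 (hEcl y h x hx.1 hxy.symm)⟩)
      (fun X hX hXne c' _ hc' => hF.exists_adj hXne (hcon' X hX) hc')
    exact hyL ⟨y, hmove x hx.1.1 (fun h => hx.2 (h ▸ hrE)) hxc y hxy hya, rfl⟩
  obtain ⟨y, hy⟩ := hY₁p.1
  have hY₁T : Y₁ ⊆ fib f (f r) \ {c} := fun x hx => (hY₁ hx).1
  obtain ⟨C, hCT, hyC, hC, hCcl⟩ := exists_component G (hY₁T hy)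
  have hrC : r ∉ C := fun h => (hY₁ hy).2 ((hC.2 (C ∩ E) Set.inter_subset_left ⟨r, h, hrE⟩
    (fun a ha b hb hab => ⟨hb, hEcl a ha.2 b (hCT hb) hab⟩) hyC).2)
  have hYC := hY₁p.inter hY₁T hCcl ⟨y, hy, hyC⟩
  have hYCs : Y₁ ∩ C ⊆ fib f (f r) := fun x hx => (hY₁T hx.1).1
  have hAY : A (Y₁ ∩ C) := hAF _ (Set.disjoint_left.2 fun v hv hvF => hFs v hvF (hYCs hv))
    (fun h => hrC h.2) hYC (hf.ncard_add_le (c := r) hYCs (fun h => hrC h.2))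
  let R := (fib f (f r) \ {c}) \ C
  have hrR : r ∈ R := ⟨⟨rfl, hcr'.symm⟩, hrC⟩
  have hRp : ∀ X ⊆ R, ¬ IsPendant G ∅ X := fun X hX hXp =>
    hA.not_disjoint f hf (f r) X (fun x hx => (hX hx).1.1) (Y₁ ∩ C) hYCs
      (hA.of_pendant X hXp (hf.ncard_add_le (c := c)
        (fun x hx => (hX hx).1.1.trans hca.symm) (fun h => (hX h).1.2 rfl)))
      hAY (Set.disjoint_left.2 fun x hx hx' => (hX hx).2 hx'.2)
  obtain ⟨g, hg, hg1, hg2⟩ := dissolve hf hca (C := R) (L := ∅) (fun x hx => hx.1.1)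
    (fun h => h.1.2 rfl)
    (fun x hx y hy hxy => by
      by_cases hyc : y = c
      · exact Or.inr hyc
      · exact Or.inl ⟨⟨hy, hyc⟩, fun h => hx.2 (hCcl y h x hx.1 hxy.symm)⟩)
    (fun X hX hXne c' _ hc' => by
      obtain ⟨x, hx, y, hxy, hyX, hyc, -⟩ := exists_adj_of_not_isPendant hXne (hRp X hX) hc'
      exact ⟨x, hx, y, hxy, hyX, hyc, fun h => h⟩)
  have hcR : c ∉ R := fun h => h.1.2 rfl
  have hgc : g c = f r := (hg1 c hcR).trans hca
  have hgp : g p = f p := hg1 p (fun h => hpa h.1.1)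
  have hfibg : ∀ x, g x = f r → x ≠ c → x ∈ C := by
    intro x hx hxc
    by_contra hxC
    have hxR : x ∉ R := fun h => (hg2 x h).1 hx
    exact hxR ⟨⟨by rw [Set.mem_ofPred_eq, ← hg1 x hxR]; exact hx, hxc⟩, hxC⟩
  have hgC : ∀ x ∈ C, g x = f r := fun x hx => (hg1 x (fun h => h.2 hx)).trans (hCT hx).1
  obtain ⟨h, hh, hh1, hh2⟩ := exists_move_to (f := g) hcp (by rw [hgc, hgp]; exact hpa.symm) (by
    rw [hgc]
    convert hC using 1
    ext x
    exact ⟨fun hx => hfibg x hx.1 hx.2, fun hx => ⟨hgC x hx, (hCT hx).2⟩⟩)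
  have hreach : Reach G f h := hg.trans hh
  have hhoff : ∀ x, x ≠ c → x ∉ R → h x = f x := fun x hxc hxR => (hh2 x hxc).trans (hg1 x hxR)
  have hhs : ∀ x, f x ≠ f r → h x = f x := fun x hx =>
    hhoff x (fun h => hx (h ▸ hca)) (fun h => hx h.1.1)
  have hhc : h c = f p := hh1.trans hgp
  have hhR : ∀ x ∈ R, h x ≠ f r := fun x hx => by
    rw [hh2 x (fun h => hcR (h ▸ hx))]
    exact (hg2 x hx).1
  have hhC : ∀ x, h x = f r → x ∈ C := by
    intro x hx
    by_cases hxc : x = c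
    · rw [hxc, hhc] at hx
      exact absurd hx hpa
    · rw [hh2 x hxc] at hx
      exact hfibg x hx hxc
  obtain ⟨k, hk, hk1, hk2⟩ := exists_reabsorb (F := F) (E := R) (a := f r) hFc
    (Set.disjoint_left.2 fun x hx hxF => hFs x hxF hx.1.1) hRp (hreach.isCol hf)
    (fun v hv => by rw [hhs v (hFs v hv)]; exact hFs v hv)
    (fun v hv x hx hxv => by
      rw [hhs v (hFs v hv), hhs x (hFs x hx)] at hxv
      exact hF v hv x hxv)
    (fun v hv x hxv => by
      rw [hhs v (hFs v hv)] at hxv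
      by_cases hxc : x = c
      · rw [hxc, hhc] at hxv
        exact absurd ⟨v, hv, hxv.symm⟩ (hLF p hpF)
      by_cases hxR : x ∈ R
      · exact Or.inr hxR
      · rw [hhoff x hxc hxR] at hxv
        rw [hF v hv x hxv]
        exact Or.inl hv)
    hhR (fun x hx y hxy hya => hx.2 (hCcl y (hhC y hya) x hx.1 hxy.symm))
  have hka : ∀ x, f x ≠ f r → k x = f x := fun x hx =>
    (hk1 x (fun h => hx h.1.1)).trans (hhs x hx)
  obtain ⟨g', hg', hg'F⟩ := exists_isolated_of_split hA hr hAF hFr hf₀ hF₀ hinj (f := k)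
    (hk.isCol (hreach.isCol hf))
    (fun x hx => by
      rw [hka x (fun h => hx (hsD h)), hoff x hx])
    (fun x hx v hv => by
      rw [← hoff v (hFa v hv)]
      by_cases hxR : x ∈ R
      · rw [← hhs v (hFs v hv)]
        exact (hk2 x hxR).2 v hv
      rw [hk1 x hxR]
      by_cases hxc : x = c
      · rw [hxc, hhc]
        exact fun h => hLF p hpF ⟨v, hv, h.symm⟩
      · rw [hhoff x hxc hxR, hoff v (hFa v hv)]
        exact hlab x hx v hv)
    (by rw [← hfr]; exact (hk2 r hrR).1) (Y := Y₁ ∩ C)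
    (fun x hx => by
      have hxR : x ∉ R := fun h => h.2 hx.2
      have hxT := hCT hx.2
      change k x = f₀ r
      rw [hk1 x hxR, hhoff x hxT.2 hxR, ← hfr]
      exact hxT.1)
    hAY (fun _ _ _ => Or.inl hcon)
  exact ⟨g', (hreach.trans hk).trans hg', hg'F⟩

/-- If the vertices of `F` are already isolated, then `r` can be isolated as well. -/
theorem exists_isolated [Finite V] {A : Set V → Prop} (hA : IsAnchor G ι A) {F : Set V}
    (hFc : Conn G Fᶜ) {r : V} (hr : r ∉ F) (hAF : AnchoredAt G ι A F r)
    (hFr : Conn G (insert r F)ᶜ) (hcard : F.ncard + 2 ≤ Nat.card ι) {f : V → ι}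
    (hf : IsCol G f) (hF : Singles f F) :
    ∃ g, Reach G f g ∧ Singles g (insert r F) := by
  obtain ⟨f₀, hf₀, hF₀, hinj⟩ := exists_concentrated hA hFc hr hAF hf hF
  have hcol := hf₀.isCol hf
  have hlift : (∃ g, Reach G f₀ g ∧ Singles g (insert r F)) →
      ∃ g, Reach G f g ∧ Singles g (insert r F) := fun ⟨g, hg, h⟩ => ⟨g, hf₀.trans hg, h⟩
  apply hlift
  by_cases hcon : Conn G (fib f₀ (f₀ r) \ {r})
  swap
  · exact exists_isolated_of_cut hA hr hAF hFr hcol hF₀ hinj hcon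
  obtain ⟨b, hb⟩ : ∃ b, b ∉ insert (f₀ r) (f₀ '' F) := by
    by_contra h
    push Not at h
    have h1 : (insert (f₀ r) (f₀ '' F)).ncard = Nat.card ι := by
      rw [Set.eq_univ_of_forall h, Set.ncard_univ]
    have h2 := Set.ncard_insert_le (f₀ r) (f₀ '' F)
    have h3 := Set.ncard_image_le (f := f₀) F.toFinite
    omega
  obtain ⟨q, hq⟩ := (hcol b).1
  have hqb : f₀ q = b := hq
  refine exists_isolated_of_not_cut hA hFc hr hAF hFr hcol hF₀ hinj hcon (q := q)
    (fun h => hb (Or.inr ⟨q, h, hqb⟩)) (fun h => hb (Or.inl (hqb.symm.trans h))) hcol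
    (fun _ _ => rfl) (fun x hx v hv h => ?_) rfl
  exact hr (by rw [hF₀ v hv r (hx.symm.trans h)]; exact hv)

end Isolation

section Peeling

variable {V : Type u} {ι : Type*} {G : SimpleGraph V}

theorem conn_support {u v : V} (p : G.Walk u v) : Conn G {x | x ∈ p.support} := by
  induction p with
  | nil => simpa using conn_singleton _
  | @cons u v w h p ih =>
    convert ih.insert (v := u) (w := v) (by simp) h using 1
    ext x
    simp

/-- A path towards `ρ` outside `F` and `B` visiting all vertices outside `F` adjacent to `F`. -/
structure IsGuide (B F : Set V) {r ρ : V} (p : G.Walk r ρ) : Prop where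
  isPath : p.IsPath
  notMem : ∀ x ∈ p.support, x ∉ F ∧ x ∉ B
  adj : ∀ x, x ∉ F → ∀ y ∈ F, G.Adj x y → x ∈ p.support

structure IsPeeled (G : SimpleGraph V) (B : Set V) (ρ : V) (F : Set V) : Prop where
  disjoint : ∀ x ∈ F, x ∉ B
  conn : Conn G Fᶜ
  exists_guide : ∃ r, ∃ p : G.Walk r ρ, IsGuide B F p

theorem IsGuide.exists_maximal [Finite V] {B F : Set V} {r ρ : V} {p : G.Walk r ρ}
    (hp : IsGuide B F p) : ∃ r', ∃ q : G.Walk r' ρ, IsGuide B F q ∧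
      ∀ z, G.Adj r' z → z ∈ F ∨ z ∈ B ∨ z ∈ q.support := by
  have := Fintype.ofFinite V
  induction hn : Fintype.card V - p.length using Nat.strong_induction_on generalizing r p with
  | _ n ih =>
  by_cases h : ∀ z, G.Adj r z → z ∈ F ∨ z ∈ B ∨ z ∈ p.support
  · exact ⟨r, p, hp, h⟩
  push Not at h
  obtain ⟨z, hrz, hzF, hzB, hzp⟩ := h
  have hlt := hp.isPath.length_lt
  refine ih (Fintype.card V - (Walk.cons hrz.symm p).length) (by
    rw [Walk.length_cons]; omega) (p := Walk.cons hrz.symm p) ⟨?_, ?_, ?_⟩ rfl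
  · exact (Walk.cons_isPath_iff _ _).2 ⟨hp.isPath, hzp⟩
  · intro x hx
    rw [Walk.support_cons, List.mem_cons] at hx
    rcases hx with rfl | hx
    · exact ⟨hzF, hzB⟩
    · exact hp.notMem x hx
  · intro x hx y hy hxy
    rw [Walk.support_cons, List.mem_cons]
    exact Or.inr (hp.adj x hx y hy hxy)

theorem IsPeeled.exists_insert [Finite V] {B : Set V} {ρ : V} (hρ : ρ ∉ B)
    (hB : ∀ x ∈ B, ∀ y, G.Adj x y → y ∈ B ∨ y = ρ) {F : Set V} (hF : IsPeeled G B ρ F)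
    (hcard : F.ncard + B.ncard + 1 < Nat.card V) :
    ∃ r, ∃ p : G.Walk r ρ, r ∉ F ∧ IsGuide B F p ∧ IsPeeled G B ρ (insert r F) := by
  obtain ⟨r₀, p₀, hp₀⟩ := hF.exists_guide
  obtain ⟨r, p, hp, hmax⟩ := hp₀.exists_maximal
  have hrp := hp.notMem r p.start_mem_support
  refine ⟨r, p, hrp.1, hp, ?_⟩
  cases p with
  | nil =>
    exfalso
    have hsub := hF.conn.2 (insert ρ B) (by
        rintro x (rfl | hx) hxF
        · exact hrp.1 hxF
        · exact hF.disjoint x hxF hx) ⟨ρ, Or.inl rfl⟩ (by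
        rintro a (rfl | ha) b hb hab
        · rcases hmax b hab with h | h | h
          · exact absurd h hb
          · exact Or.inr h
          · exact Or.inl (by simpa using h)
        · exact (hB a ha b hab).symm)
    have h1 := Set.ncard_le_ncard hsub
    have h2 := Set.ncard_insert_le ρ B
    have h3 := Set.ncard_add_ncard_compl F
    omega
  | @cons _ z _ h p =>
    obtain ⟨hpp, hrp'⟩ := (Walk.cons_isPath_iff _ _).1 hp.isPath
    have hrρ : r ≠ ρ := fun h => hrp' (h ▸ p.end_mem_support)
    have hps : ∀ x ∈ p.support, x ∉ F ∧ x ∉ B := fun x hx =>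
      hp.notMem x (by rw [Walk.support_cons]; exact List.mem_cons_of_mem _ hx)
    have hpr : ∀ x ∈ p.support, x ∈ (insert r F)ᶜ := by
      rintro x hx (rfl | h)
      · exact hrp' hx
      · exact (hps x hx).1 h
    have hrn : ∀ y, G.Adj r y → y ∈ F ∨ y ∈ p.support := by
      intro y hy
      rcases hmax y hy with h | h | h
      · exact Or.inl h
      · rcases hB y h r hy.symm with h' | h'
        · exact absurd h' hrp.2
        · exact absurd h' hrρ
      · rw [Walk.support_cons, List.mem_cons] at h
        exact Or.inr (h.resolve_left hy.ne')
    have hmeet : ∀ A ⊆ (insert r F)ᶜ, A.Nonempty →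
        (∀ a ∈ A, ∀ b ∈ (insert r F)ᶜ, G.Adj a b → b ∈ A) → ∀ x ∈ p.support, x ∈ A := by
      intro A hA hne hcl x hx
      have hne' : (A ∩ {x | x ∈ p.support}).Nonempty := by
        by_contra hemp
        refine hA (hF.conn.2 A (fun x hx h => hA hx (Or.inr h)) hne
          (fun a ha b hb hab => hcl a ha b ?_ hab) hrp.1) (Or.inl rfl)
        rintro (rfl | h)
        · rcases hrn a hab.symm with h | h
          · exact hA ha (Or.inr h)
          · exact hemp ⟨a, ha, h⟩
        · exact hb h
      exact ((conn_support p).2 _ Set.inter_subset_right hne'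
        (fun a ha b hb hab => ⟨hcl a ha.1 b (hpr b hb) hab, hb⟩) hx).1
    refine ⟨?_, ⟨⟨z, hpr z p.start_mem_support⟩, fun A hA hne hcl => ?_⟩, z, p, hpp, ?_, ?_⟩
    · rintro x (rfl | hx)
      · exact hrp.2
      · exact hF.disjoint x hx
    · by_contra hSA
      obtain ⟨s, hs, hsA⟩ := Set.not_subset.1 hSA
      have h1 := hmeet A hA hne hcl z p.start_mem_support
      have h2 := hmeet ((insert r F)ᶜ \ A) Set.sdiff_subset ⟨s, hs, hsA⟩
        (fun a ha b hb hab => ⟨hb, fun h => ha.2 (hcl b h a ha.1 hab.symm)⟩) z p.start_mem_support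
      exact h2.2 h1
    · exact fun x hx => ⟨hpr x hx, (hps x hx).2⟩
    · rintro x hx y (rfl | hy) hxy
      · exact (hrn x hxy.symm).resolve_left (fun h => hx (Or.inr h))
      · have := hp.adj x (fun h => hx (Or.inr h)) y hy hxy
        rw [Walk.support_cons, List.mem_cons] at this
        exact this.resolve_left (fun h => hx (Or.inl h))

theorem IsGuide.anchoredAt {A : Set V → Prop} (hA : IsAnchor G ι A) {B : Set V} {ρ : V}
    (hAB : ∀ X, ρ ∈ X → (∀ x ∈ X, x ∈ B → ∀ y ∈ B, G.Adj x y → y ∈ X) →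
      (∀ y ∈ B, G.Adj ρ y → y ∈ X) → A X)
    {F : Set V} (hF : ∀ x ∈ F, x ∉ B) {r : V} {p : G.Walk r ρ} (hp : IsGuide B F p) :
    AnchoredAt G ι A F r := by
  classical
  intro X hXF hrX hX hcard
  by_cases hreal : IsPendant G ∅ X
  · exact hA.of_pendant X hreal hcard
  obtain ⟨hne, c, hcX, hc⟩ := hX
  obtain ⟨y, hyX, w, hyw, -, -, hwF⟩ : ∃ y ∈ X, ∃ w, G.Adj y w ∧ w ∉ X ∧ w ≠ c ∧ w ∈ F := by
    obtain ⟨y, hy, w, hyw, hwX, hwc, -⟩ := exists_adj_of_not_isPendant hne hreal hcX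
    refine ⟨y, hy, w, hyw, hwX, hwc, ?_⟩
    rcases hc y hy w hyw with h | h | h
    · exact absurd h hwX
    · exact absurd h hwc
    · exact h
  have hyp := hp.adj y (fun h => Set.disjoint_left.1 hXF hyX h) w hwF hyw
  have hcross : ∀ {u : V} (q : G.Walk u y), u ∉ X → (∀ x ∈ q.support, x ∈ p.support) →
      c ∈ q.support := by
    intro u q hu hq
    obtain ⟨d, hd, hd1, hd2⟩ := q.exists_boundary_dart Xᶜ hu (fun h => h hyX)
    have hdX : d.snd ∈ X := not_not.1 hd2
    have hds := q.dart_fst_mem_support_of_mem_darts hd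
    rcases hc d.snd hdX d.fst d.adj.symm with h | h | h
    · exact absurd h hd1
    · exact h ▸ hds
    · exact absurd h (hp.notMem _ (hq _ hds)).1
  have hc1 := hcross (p.takeUntil y hyp) hrX (fun x hx => p.support_takeUntil_subset_support hyp hx)
  have hcB : c ∉ B := (hp.notMem c (p.support_takeUntil_subset_support hyp hc1)).2
  have hnB : ∀ x ∈ X, ∀ b ∈ B, G.Adj x b → b ∈ X := by
    intro x hx b hb hxb
    rcases hc x hx b hxb with h | h | h
    · exact h
    · exact absurd (h ▸ hb) hcB
    · exact absurd hb (hF b h)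
  have hρ : ρ ∈ X := by
    by_contra hρX
    have hc2 := hcross (p.dropUntil y hyp).reverse hρX (fun x hx => by
      rw [Walk.support_reverse, List.mem_reverse] at hx
      exact p.support_dropUntil_subset_support hyp hx)
    rw [Walk.support_reverse, List.mem_reverse] at hc2
    have hnd := hp.isPath.support_nodup
    rw [← p.take_spec hyp, Walk.support_append, List.nodup_append] at hnd
    have hcy : c ≠ y := fun h => hcX (h ▸ hyX)
    rw [← Walk.cons_tail_support, List.mem_cons] at hc2
    exact hnd.2.2 c hc1 c (hc2.resolve_left hcy) rfl
  exact hAB X hρ (fun x hx _ => hnB x hx) (fun b hb => hnB ρ hρ b hb)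

/-- All colourings can be brought to one in which the same `|ι| - 1` vertices are isolated. -/
theorem exists_common_singles [Finite V] (hG : Conn G Set.univ) {A : Set V → Prop}
    (hA : IsAnchor G ι A) {B : Set V} {ρ : V} (hρ : ρ ∉ B)
    (hB : ∀ x ∈ B, ∀ y, G.Adj x y → y ∈ B ∨ y = ρ) (hBcard : B.ncard + Nat.card ι ≤ Nat.card V)
    (hAB : ∀ X, ρ ∈ X → (∀ x ∈ X, x ∈ B → ∀ y ∈ B, G.Adj x y → y ∈ X) →
      (∀ y ∈ B, G.Adj ρ y → y ∈ X) → A X) (i : ℕ) (hi : i + 1 ≤ Nat.card ι) :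
    ∃ F : Set V, F.ncard = i ∧ IsPeeled G B ρ F ∧
      ∀ f : V → ι, IsCol G f → ∃ g, Reach G f g ∧ Singles g F := by
  induction i with
  | zero =>
    refine ⟨∅, by simp, ⟨by simp, by simpa using hG, ρ, Walk.nil, by simp, ?_, by simp⟩, ?_⟩
    · simpa using hρ
    · exact fun f _ => ⟨f, .refl, fun v hv => hv.elim⟩
  | succ i ih =>
    obtain ⟨F, hFi, hF, hred⟩ := ih (by omega)
    obtain ⟨r, p, hrF, hp, hFr⟩ := hF.exists_insert hρ hB (by omega)
    refine ⟨insert r F, by rw [Set.ncard_insert_of_notMem hrF, hFi], hFr, fun f hf => ?_⟩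
    obtain ⟨g, hg, hgF⟩ := hred f hf
    obtain ⟨h, hh, hhF⟩ := exists_isolated hA hF.conn hrF (hp.anchoredAt hA hAB hF.disjoint)
      hFr.conn (by omega) (hg.isCol hf) hgF
    exact ⟨h, hg.trans hh, hhF⟩

theorem range_fib_eq [Finite V] [Finite ι] {f : V → ι} {F : Set V}
    (hF : Singles f F) (hcard : F.ncard + 1 = Nat.card ι) :
    Set.range (fib f) = insert Fᶜ ((fun v => ({v} : Set V)) '' F) := by
  have hinj : Set.InjOn f F := fun v _ w hw h => hF w hw v h
  have h1 : (f '' F)ᶜ.ncard = 1 := by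
    have h2 := Set.ncard_add_ncard_compl (f '' F)
    rw [hinj.ncard_image] at h2
    omega
  obtain ⟨b, hb⟩ := Set.ncard_eq_one.1 h1
  have hfibF : ∀ v ∈ F, fib f (f v) = {v} := fun v hv =>
    Set.eq_singleton_iff_unique_mem.2 ⟨rfl, fun x hx => hF v hv x hx⟩
  have hfibb : fib f b = Fᶜ := by
    ext x
    constructor
    · intro hx hxF
      have : b ∈ (f '' F)ᶜ := by rw [hb]; rfl
      exact this ⟨x, hxF, hx⟩
    · intro hx
      have : f x ∈ (f '' F)ᶜ := by
        rintro ⟨v, hv, hvx⟩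
        exact hx (by rw [hF v hv x hvx.symm]; exact hv)
      rw [hb] at this
      exact this
  ext s
  constructor
  · rintro ⟨a, rfl⟩
    by_cases ha : a ∈ f '' F
    · obtain ⟨v, hv, rfl⟩ := ha
      exact Or.inr ⟨v, hv, (hfibF v hv).symm⟩
    · have : a ∈ (f '' F)ᶜ := ha
      rw [hb] at this
      obtain rfl : a = b := this
      exact Or.inl hfibb
  · rintro (rfl | ⟨v, hv, rfl⟩)
    · exact ⟨b, hfibb⟩
    · exact ⟨f v, hfibF v hv⟩

end Peeling

section Bridge

variable {V : Type u} {G : SimpleGraph V} {k : ℕ}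

theorem districtMap_ext {P Q : DistrictMap G k} (h : P.parts = Q.parts) : P = Q := by
  cases P
  cases Q
  cases h
  rfl

/-- The district map formed by the classes of a labelling. -/
def toMap (f : V → Fin k) (hf : IsCol G f) : DistrictMap G k where
  parts := Set.range (fib f)
  ncard_parts := by
    have hinj : Function.Injective (fib f) := fun a b hab => by
      obtain ⟨x, hx⟩ := (hf a).1
      have hx' : x ∈ fib f b := hab ▸ hx
      exact hx.symm.trans hx'
    rw [← Set.image_univ, Set.ncard_image_of_injective _ hinj, Set.ncard_univ, Nat.card_fin]
  nonempty_mem := by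
    rintro _ ⟨a, rfl⟩
    exact (hf a).1
  pairwise_disjoint := by
    rintro _ ⟨a, rfl⟩ _ ⟨b, rfl⟩ hab
    refine Set.disjoint_left.2 fun x hx hx' => hab ?_
    rw [show a = b from hx.symm.trans hx']
  covers v := ⟨fib f (f v), ⟨f v, rfl⟩, rfl⟩
  connected_mem := by
    rintro _ ⟨a, rfl⟩
    exact conn_iff.1 (hf a)

theorem notMem_part {P : DistrictMap G k} {s t : Set V} (hs : s ∈ P.parts) (ht : t ∈ P.parts)
    (hne : s ≠ t) {x : V} (hx : x ∈ s) : x ∉ t :=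
  Set.disjoint_left.1 (P.pairwise_disjoint hs ht hne) hx

theorem exists_toMap_eq (hk : 1 ≤ k) (P : DistrictMap G k) :
    ∃ f : V → Fin k, ∃ hf : IsCol G f, toMap f hf = P := by
  have hfin : P.parts.Finite := Set.finite_of_ncard_pos (by rw [P.ncard_parts]; omega)
  have := hfin.to_subtype
  have e : P.parts ≃ Fin k := Finite.equivFinOfCardEq P.ncard_parts
  choose p hp hvp using P.covers
  have hpe : ∀ s (hs : s ∈ P.parts) v, v ∈ s → p v = s := fun s hs v hv => by
    by_contra hne
    exact notMem_part (hp v) hs hne (hvp v) hv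
  have hfib : ∀ s : P.parts, fib (fun v => e ⟨p v, hp v⟩) (e s) = s := by
    rintro ⟨s, hs⟩
    ext x
    simp only [Set.mem_ofPred_eq, EmbeddingLike.apply_eq_iff_eq, Subtype.mk.injEq]
    exact ⟨fun h => h ▸ hvp x, hpe s hs x⟩
  refine ⟨fun v => e ⟨p v, hp v⟩, fun a => ?_, districtMap_ext (Set.ext fun s => ⟨?_, fun hs => ?_⟩)⟩
  · rw [← e.apply_symm_apply a, hfib]
    exact conn_iff.2 (P.connected_mem _ (e.symm a).2)
  · rintro ⟨a, rfl⟩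
    rw [← e.apply_symm_apply a, hfib]
    exact (e.symm a).2
  · exact ⟨e ⟨s, hs⟩, hfib ⟨s, hs⟩⟩

theorem switchOut_of_move {f g : V → Fin k} (hf : IsCol G f) (hg : IsCol G g) {v w : V}
    (hvw : G.Adj v w) (hne : f v ≠ f w) (hcon : Conn G (fib f (f v) \ {v})) (hv : g v = f w)
    (hx : ∀ x, x ≠ v → g x = f x) :
    SwitchOut (toMap f hf) (toMap g hg) (fib f (f v)) (fib f (f v) \ {v}) := by
  obtain ⟨b, hb⟩ := hcon.1
  obtain ⟨v', hv', u, hu, -, hvu⟩ := (hf (f v)).exists_adj (A := {v})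
    (by rintro _ rfl; rfl) ⟨v, rfl⟩ hb.1 hb.2
  obtain rfl : v = v' := hv'.symm
  have hinj : ∀ {a b : Fin k}, fib f a = fib f b → a = b := fun {a b} hab => by
    obtain ⟨x, hx⟩ := (hf a).1
    have hx' : x ∈ fib f b := hab ▸ hx
    exact hx.symm.trans hx'
  refine ⟨u, v, w, fib f (f w), hvu.symm, hvw, ⟨f v, rfl⟩, ⟨f w, rfl⟩, hu, rfl, rfl,
    fun h => hne (hinj h), rfl, hcon.1, conn_iff.1 hcon, ?_⟩
  change Set.range (fib g) = (Set.range (fib f) \ _) ∪ _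
  rw [← fib_move_old hne hv hx, ← fib_move_new hv hx]
  ext s
  constructor
  · rintro ⟨a, rfl⟩
    by_cases h1 : a = f v
    · exact Or.inr (Or.inl (by rw [h1]))
    by_cases h2 : a = f w
    · exact Or.inr (Or.inr (by rw [h2]; rfl))
    refine Or.inl ⟨⟨a, (fib_move_other hv hx h1 h2).symm⟩, ?_⟩
    rw [fib_move_other hv hx h1 h2]
    rintro (h | h)
    · exact h1 (hinj h)
    · exact h2 (hinj h)
  · rintro (⟨⟨a, rfl⟩, h⟩ | rfl | rfl)
    · refine ⟨a, fib_move_other hv hx ?_ ?_⟩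
      · rintro rfl
        exact h (Or.inl rfl)
      · rintro rfl
        exact h (Or.inr rfl)
    · exact ⟨_, rfl⟩
    · exact ⟨_, rfl⟩

theorem switch_of_switchOut {P Q : DistrictMap G k} {s s' : Set V} (h : SwitchOut P Q s s') :
    Switch P Q := by
  obtain ⟨u, v, w, sw, h1, h2, h3, h4, h5, h6, h7, h8, rfl, h9⟩ := h
  exact ⟨u, v, w, s, sw, h1, h2, h3, h4, h5, h6, h7, h8, h9⟩

theorem Reach.toMap {f g : V → Fin k} (hf : IsCol G f) (hg : IsCol G g) (h : Reach G f g) :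
    Relation.ReflTransGen SwitchAdj (toMap f hf) (toMap g hg) := by
  induction h with
  | refl => exact .refl
  | @tail b c hab hbc ih =>
    have hb : IsCol G b := Reach.isCol hf hab
    refine (ih hb).tail (Or.inl ?_)
    obtain ⟨v, w, hvw, hne, hcon, hv, hx⟩ := hbc
    exact switch_of_switchOut (switchOut_of_move hb hg hvw hne hcon hv hx)

theorem exists_switchOut (hk : 1 ≤ k) {P : DistrictMap G k} {s : Set V} (hs : s ∈ P.parts)
    {v w : V} (hv : v ∈ s) (hcon : Conn G (s \ {v})) (hw : w ∉ s) (hvw : G.Adj v w) :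
    ∃ Q : DistrictMap G k, s \ {v} ∈ Q.parts ∧ SwitchOut P Q s (s \ {v}) := by
  classical
  obtain ⟨f, hf, rfl⟩ := exists_toMap_eq hk P
  obtain ⟨a, rfl⟩ := hs
  obtain rfl : f v = a := hv
  have hne : f v ≠ f w := fun h => hw h.symm
  have hgv : Function.update f v (f w) v = f w := by simp
  have hgx : ∀ x, x ≠ v → Function.update f v (f w) x = f x := fun x hx => by simp [hx]
  have hg : IsCol G (Function.update f v (f w)) :=
    Move.isCol hf ⟨v, w, hvw, hne, hcon, hgv, hgx⟩
  exact ⟨toMap _ hg, ⟨f v, fib_move_old hne hgv hgx⟩,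
    switchOut_of_move hf hg hvw hne hcon hgv hgx⟩

theorem subset_of_switchOut {X Y : Set V} (hX : IsPendant G ∅ X) (hY : IsPendant G ∅ Y)
    (hXY : Disjoint X Y) {P Q : DistrictMap G k} {s s' : Set V} (h : SwitchOut P Q s s')
    (hs : X ∪ Y ⊆ s) : X ∪ Y ⊆ s' := by
  obtain ⟨u, v, w, sw, -, hvw, hsP, hswP, -, -, hw, hne, rfl, -⟩ := h
  have hD : Conn G s := conn_iff.2 (P.connected_mem s hsP)
  have hws : w ∉ s := notMem_part hswP hsP hne.symm hw
  have hXs := Set.subset_union_left.trans hs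
  have hYs := Set.subset_union_right.trans hs
  rintro x (hx | hx)
  · refine ⟨hXs hx, ?_⟩
    rintro rfl
    exact notMem_pendant_of_adj hX hY hXY hD hXs hYs hws hvw hx
  · refine ⟨hYs hx, ?_⟩
    rintro rfl
    exact notMem_pendant_of_adj hY hX hXY.symm hD hYs hXs hws hvw hx

theorem exists_subset_part_iff {X Y : Set V} (hX : IsPendant G ∅ X) (hY : IsPendant G ∅ Y)
    (hXY : Disjoint X Y) {P Q : DistrictMap G k} (h : Switch P Q) :
    (∃ s ∈ P.parts, X ∪ Y ⊆ s) ↔ ∃ s ∈ Q.parts, X ∪ Y ⊆ s := by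
  obtain ⟨u, v, w, su, sw, huv, hvw, hsu, hsw, hu, hv, hw, hne, hnon, hcon, hQ⟩ := h
  constructor
  · rintro ⟨s, hs, hXYs⟩
    by_cases h1 : s = su
    · subst h1
      refine ⟨s \ {v}, hQ ▸ Or.inr (Or.inl rfl), subset_of_switchOut hX hY hXY
        (Q := Q) ⟨u, v, w, sw, huv, hvw, hsu, hsw, hu, hv, hw, hne, rfl, hnon, hcon, hQ⟩ hXYs⟩
    by_cases h2 : s = sw
    · subst h2
      exact ⟨insert v s, hQ ▸ Or.inr (Or.inr rfl), hXYs.trans (Set.subset_insert v s)⟩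
    · exact ⟨s, hQ ▸ Or.inl ⟨hs, by simp [h1, h2]⟩, hXYs⟩
  · rintro ⟨s, hs, hXYs⟩
    have hs' := hs
    rw [hQ] at hs'
    rcases hs' with h | rfl | rfl
    · exact ⟨s, h.1, hXYs⟩
    · exact ⟨su, hsu, hXYs.trans Set.sdiff_subset⟩
    · have hD : Conn G (insert v sw) := conn_iff.2 (Q.connected_mem _ hs)
      have hus : u ∉ insert v sw := by
        rintro (rfl | h)
        · exact huv.ne rfl
        · exact notMem_part hsu hsw hne hu h
      have hXs := Set.subset_union_left.trans hXYs
      have hYs := Set.subset_union_right.trans hXYs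
      refine ⟨sw, hsw, fun x hx => (hXYs hx).resolve_left ?_⟩
      rintro rfl
      rcases hx with hx | hx
      · exact notMem_pendant_of_adj hX hY hXY hD hXs hYs hus huv.symm hx
      · exact notMem_pendant_of_adj hY hX hXY.symm hD hYs hXs hus huv.symm hx

end Bridge

section Forward

variable {V : Type u} {G : SimpleGraph V} {k : ℕ}

/-- A connected set together with the singletons outside it. -/
theorem exists_map_insert [Finite V] {T : Set V} (hT : Conn G T)
    (hcard : T.ncard + k = Nat.card V + 1) :
    ∃ P : DistrictMap G k, P.parts = insert T ((fun v => ({v} : Set V)) '' Tᶜ) := by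
  refine ⟨⟨insert T ((fun v => ({v} : Set V)) '' Tᶜ), ?_, ?_, ?_, ?_, ?_⟩, rfl⟩
  · rw [Set.ncard_insert_of_notMem, Set.ncard_image_of_injective _ Set.singleton_injective]
    · have := Set.ncard_add_ncard_compl T
      omega
    · rintro ⟨z, hz, rfl⟩
      exact hz rfl
  · rintro _ (rfl | ⟨z, -, rfl⟩)
    · exact hT.1
    · exact ⟨z, rfl⟩
  · rintro _ (rfl | ⟨y, hy, rfl⟩) _ (rfl | ⟨z, hz, rfl⟩) hne
    · exact absurd rfl hne
    · exact Set.disjoint_singleton_right.2 hz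
    · exact Set.disjoint_singleton_left.2 hy
    · exact Set.disjoint_singleton.2 fun h => hne (by rw [h])
  · intro v
    by_cases hv : v ∈ T
    · exact ⟨T, Or.inl rfl, hv⟩
    · exact ⟨{v}, Or.inr ⟨v, hv, rfl⟩, rfl⟩
  · rintro _ (rfl | ⟨z, -, rfl⟩)
    · exact conn_iff.1 hT
    · exact conn_iff.1 (conn_singleton z)

theorem conn_compl_singleton (hG : Conn G Set.univ) {s : Set V} {x : V}
    (hs : Conn G (s \ {x})) (hx : ∀ y, G.Adj x y → y ∈ s) : Conn G {x}ᶜ := by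
  obtain ⟨b, hb⟩ := hs.1
  refine ⟨⟨b, hb.2⟩, fun A hA hne hcl => ?_⟩
  by_cases h : (A ∩ (s \ {x})).Nonempty
  · have hsA : s \ {x} ⊆ A := fun y hy => (hs.2 _ Set.inter_subset_right h
      (fun a ha b hb hab => ⟨hcl a ha.1 b hb.2 hab, hb⟩) hy).1
    have huniv := hG.2 (insert x A) (Set.subset_univ _) ⟨x, Or.inl rfl⟩ (by
      rintro a (rfl | ha) b - hab
      · exact Or.inr (hsA ⟨hx b hab, hab.ne'⟩)
      · exact (em (b = x)).imp id fun hbx => hcl a ha b hbx hab)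
    exact fun y hy => (huniv (Set.mem_univ y)).resolve_left hy
  · have huniv := hG.2 A (Set.subset_univ _) hne (fun a ha b _ hab => by
      refine hcl a ha b ?_ hab
      rintro rfl
      exact h ⟨a, ha, hx a hab.symm, hA ha⟩)
    exact fun y _ => huniv (Set.mem_univ y)

theorem exists_switchable [Finite V] (hG : Conn G Set.univ) (hk2 : 2 ≤ k) (hk : k ≤ Nat.card V)
    (hcon : ∀ P Q : DistrictMap G k, Relation.ReflTransGen SwitchAdj P Q) (P : DistrictMap G k)
    {s : Set V} (hs : s ∈ P.parts) (hcard : 2 ≤ s.ncard) :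
    ∃ v ∈ s, Conn G (s \ {v}) ∧ ∃ w, w ∉ s ∧ G.Adj v w := by
  by_contra hno
  push Not at hno
  have hsC : Conn G s := conn_iff.2 (P.connected_mem s hs)
  obtain ⟨t, ht, hts⟩ := Set.exists_ne_of_one_lt_ncard (s := P.parts) (by
    rw [P.ncard_parts]; omega) s
  obtain ⟨z, hz⟩ := P.nonempty_mem t ht
  obtain ⟨c, hc, w, -, hw, hcw⟩ := hG.exists_adj (Set.subset_univ s) hsC.1 (Set.mem_univ z)
    (notMem_part ht hs hts hz)
  have hsc : ¬ Conn G (s \ {c}) := fun h => hno c hc h w hw hcw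
  obtain ⟨d, hd, hdc⟩ := Set.exists_ne_of_one_lt_ncard (s := s) (by omega) c
  obtain ⟨A, hA, hAne, hAne', hcl⟩ :=
    exists_separation (T := s \ {c}) ⟨d, hd, hdc⟩ hsc
  have hpend : ∀ C ⊆ s \ {c}, C.Nonempty →
      (∀ a ∈ C, ∀ b ∈ s \ {c}, G.Adj a b → b ∈ C) →
      ∃ X ⊆ C, IsPendant G ∅ X ∧ ∃ x ∈ X, Conn G {x}ᶜ := by
    intro C hC hne hcl
    obtain ⟨X, hXC, hX, ⟨c', -, hc'X, hc'⟩, hun⟩ := exists_uncut_pendant hsC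
      (hC.trans Set.sdiff_subset) hne hc (fun h => (hC h).2 rfl) (fun x hx y hy hxy =>
        (em (y = c)).symm.imp (fun h => hcl x hx y ⟨hy, h⟩ hxy) id)
    have hnb : ∀ x ∈ X, ∀ y, G.Adj x y → y ∈ s := fun x hx y hxy => by
      by_contra hy
      exact hno x (hC (hXC hx)).1 (hun x hx) y hy hxy
    obtain ⟨x, hx⟩ := hX
    refine ⟨X, hXC, ⟨⟨x, hx⟩, c', hc'X, fun x hx y hxy => ?_⟩, x, hx,
      conn_compl_singleton hG (hun x hx) (hnb x hx)⟩
    exact (hc' x hx y (hnb x hx y hxy) hxy).imp id Or.inl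
  obtain ⟨X, hXA, hX, x, hx, hxc⟩ := hpend A hA hAne hcl
  obtain ⟨Y, hYA, hY, -⟩ := hpend ((s \ {c}) \ A) Set.sdiff_subset hAne'
    (fun a ha b hb hab => ⟨hb, fun h => ha.2 (hcl b h a ha.1 hab.symm)⟩)
  have hXY : Disjoint X Y := Set.disjoint_left.2 fun y hy hy' => (hYA hy').2 (hXA hy)
  have hn := Set.ncard_add_ncard_compl ({x} : Set V)
  rw [Set.ncard_singleton] at hn
  obtain ⟨T, hT, hTc, hTn⟩ := hxc.exists_subset_ncard (m := Nat.card V + 1 - k) (by omega)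
    (by omega)
  obtain ⟨Q, hQ⟩ := exists_map_insert (k := k) hTc (by omega)
  have hinv : ∃ q ∈ Q.parts, X ∪ Y ⊆ q := by
    have hstart : ∃ p ∈ P.parts, X ∪ Y ⊆ p := ⟨s, hs, Set.union_subset
      (fun y hy => (hA (hXA hy)).1) (fun y hy => (hYA hy).1.1)⟩
    have hreach := hcon P Q
    clear hQ
    induction hreach with
    | refl => exact hstart
    | tail _ h ih =>
      rcases h with h | h
      · exact (exists_subset_part_iff hX hY hXY h).1 ih
      · exact (exists_subset_part_iff hX hY hXY h).2 ih
  obtain ⟨q, hq, hXYq⟩ := hinv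
  rw [hQ] at hq
  rcases hq with rfl | ⟨z, -, rfl⟩
  · exact hT (hXYq (Or.inl hx)) rfl
  · obtain ⟨y, hy⟩ := hY.1
    have h1 : x = z := hXYq (Or.inl hx)
    have h2 : y = z := hXYq (Or.inr hy)
    exact Set.disjoint_left.1 hXY hx (h1.trans h2.symm ▸ hy)

theorem contractibleDistrict_of_exists_switchable [Finite V] (hk : 1 ≤ k)
    (h : ∀ (P : DistrictMap G k) (s : Set V), s ∈ P.parts → 2 ≤ s.ncard →
      ∃ v ∈ s, Conn G (s \ {v}) ∧ ∃ w, w ∉ s ∧ G.Adj v w)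
    (P : DistrictMap G k) {s : Set V} (hs : s ∈ P.parts) : ContractibleDistrict P s := by
  induction hn : s.ncard generalizing P s with
  | zero =>
    rw [Set.ncard_eq_zero] at hn
    exact absurd (P.nonempty_mem s hs) (by simp [hn])
  | succ n ih =>
    by_cases hn1 : n = 0
    · obtain ⟨t, rfl⟩ := Set.ncard_eq_one.1 (hn.trans (by omega))
      exact ⟨t, hs, fun _ => P, fun _ => {t}, rfl, rfl, rfl, fun i hi => by simp at hi⟩
    · obtain ⟨v, hv, hcon, w, hw, hvw⟩ := h P s hs (by omega)
      obtain ⟨Q, hsQ, hQ⟩ := exists_switchOut hk hs hv hcon hw hvw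
      have hcard : (s \ {v}).ncard = n := by
        rw [Set.ncard_sdiff_singleton_of_mem hv]
        omega
      obtain ⟨t, -, f, g, hf, hg, hgt, hfg⟩ := ih Q hsQ hcard
      refine ⟨t, hs, fun i => Nat.casesOn i P f, fun i => Nat.casesOn i s g, rfl, rfl, ?_, ?_⟩
      · rw [hn, show n + 1 - 1 = (n - 1) + 1 by omega, ← hgt, hcard]
      · rintro (_ | i) hi
        · simpa [hf, hg] using hQ
        · exact hfg i (by omega)

end Forward

section Backward

variable {V : Type u} {G : SimpleGraph V} {k : ℕ}

theorem not_disjoint_of_contractibleDistrict {P : DistrictMap G k} {s : Set V}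
    (h : ContractibleDistrict P s) {X Y : Set V} (hX : IsPendant G ∅ X) (hY : IsPendant G ∅ Y)
    (hXs : X ⊆ s) (hYs : Y ⊆ s) : ¬ Disjoint X Y := by
  intro hXY
  obtain ⟨t, -, f, g, -, hg, hgt, hfg⟩ := h
  have hind : ∀ i ≤ s.ncard - 1, X ∪ Y ⊆ g i := by
    intro i hi
    induction i with
    | zero => rw [hg]; exact Set.union_subset hXs hYs
    | succ i ih => exact subset_of_switchOut hX hY hXY (hfg i hi) (ih (by omega))
  have hsub := hind _ le_rfl
  rw [hgt] at hsub
  obtain ⟨x, hx⟩ := hX.1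
  obtain ⟨y, hy⟩ := hY.1
  have h1 : x = t := hsub (Or.inl hx)
  have h2 : y = t := hsub (Or.inr hy)
  exact Set.disjoint_left.1 hXY hx (h1.trans h2.symm ▸ hy)

theorem exists_common_parts [Finite V] (hG : Conn G Set.univ) (hk1 : 1 ≤ k)
    (hk : k ≤ Nat.card V) (h : ∀ P : DistrictMap G k, ContractibleMap P) :
    ∃ S : Set (Set V), ∀ f : V → Fin k, IsCol G f →
      ∃ g, Reach G f g ∧ Set.range (fib g) = S := by
  suffices hsuf : ∃ F : Set V, F.ncard = k - 1 ∧ ∀ f : V → Fin k, IsCol G f →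
      ∃ g, Reach G f g ∧ Singles g F by
    obtain ⟨F, hFk, hF⟩ := hsuf
    refine ⟨insert Fᶜ ((fun v => ({v} : Set V)) '' F), fun f hf => ?_⟩
    obtain ⟨g, hg, hgF⟩ := hF f hf
    exact ⟨g, hg, range_fib_eq hgF (by rw [Nat.card_fin]; omega)⟩
  have hi : k - 1 + 1 ≤ Nat.card (Fin k) := by rw [Nat.card_fin]; omega
  by_cases hex : ∃ X, IsPendant G ∅ X ∧ X.ncard + k ≤ Nat.card V
  · obtain ⟨B, hBp, hBcard⟩ := hex
    have hBp' := hBp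
    obtain ⟨hBne, ρ, hρ, hB⟩ := hBp'
    have hB' : ∀ x ∈ B, ∀ y, G.Adj x y → y ∈ B ∨ y = ρ := fun x hx y hxy => by
      simpa using hB x hx y hxy
    obtain ⟨a, ha, b, -, hb, hab⟩ := hG.exists_adj (Set.subset_univ B) hBne (Set.mem_univ ρ) hρ
    obtain rfl : b = ρ := (hB' a ha b hab).resolve_left hb
    have hA : IsAnchor G (Fin k) (fun X => ∃ Z ⊆ X, IsPendant G ∅ Z) := by
      refine ⟨fun f hf a X hX Y hY => ?_, fun X hX _ => ⟨X, subset_rfl, hX⟩⟩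
      rintro ⟨Z, hZX, hZ⟩ ⟨W, hWY, hW⟩ hXY
      exact not_disjoint_of_contractibleDistrict (h (toMap f hf) (fib f a) ⟨a, rfl⟩) hZ hW
        (hZX.trans hX) (hWY.trans hY) (hXY.mono hZX hWY)
    obtain ⟨F, hF, -, hred⟩ := exists_common_singles hG hA hρ hB'
      (by rw [Nat.card_fin]; exact hBcard) (fun X _ hcl hbX =>
        ⟨X ∩ B, Set.inter_subset_left, ⟨a, hbX a ha hab.symm, ha⟩, b, fun h => hρ h.2,
          fun x hx y hxy => (hB' x hx.2 y hxy).imp (fun hy => ⟨hcl x hx.1 hx.2 y hy hxy, hy⟩)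
            Or.inl⟩) (k - 1) hi
    exact ⟨F, hF, hred⟩
  · obtain ⟨ρ, -⟩ := hG.1
    have hA : IsAnchor G (Fin k) (fun X => ρ ∈ X) :=
      ⟨fun f _ a X _ Y _ hX hY hXY => Set.disjoint_left.1 hXY hX hY,
        fun X hX hc => absurd ⟨X, hX, by rwa [Nat.card_fin] at hc⟩ hex⟩
    obtain ⟨F, hF, -, hred⟩ := exists_common_singles hG hA (B := ∅) (ρ := ρ) (by simp)
      (by simp) (by simpa using hk) (fun X hX _ _ => hX) (k - 1) hi
    exact ⟨F, hF, hred⟩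

theorem exists_common_parts_one : ∃ S : Set (Set V), ∀ f : V → Fin 1, IsCol G f →
    ∃ g, Reach G f g ∧ Set.range (fib g) = S :=
  ⟨Set.range (fib fun _ => 0), fun f _ =>
    ⟨f, .refl, congrArg (fun g => Set.range (fib g)) (Subsingleton.elim f _)⟩⟩

theorem reflTransGen_of_common_parts (hk : 1 ≤ k)
    (h : ∃ S : Set (Set V), ∀ f : V → Fin k, IsCol G f →
      ∃ g, Reach G f g ∧ Set.range (fib g) = S) (P Q : DistrictMap G k) :
    Relation.ReflTransGen SwitchAdj P Q := by
  obtain ⟨S, hS⟩ := h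
  have hred : ∀ P : DistrictMap G k, ∃ R : DistrictMap G k, R.parts = S ∧
      Relation.ReflTransGen SwitchAdj P R := by
    intro P
    obtain ⟨f, hf, rfl⟩ := exists_toMap_eq hk P
    obtain ⟨g, hg, hgS⟩ := hS f hf
    exact ⟨toMap g (Reach.isCol hf hg), hgS, Reach.toMap hf _ hg⟩
  obtain ⟨R, hR, hPR⟩ := hred P
  obtain ⟨R', hR', hQR⟩ := hred Q
  obtain rfl : R = R' := districtMap_ext (hR.trans hR'.symm)
  exact hPR.trans (Relation.ReflTransGen.mono (fun _ _ h => h.symm) _ _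
    (Relation.reflTransGen_swap.2 hQR))

end Backward

end SwitchGraph

/-- `Γ_k(G)` is connected iff `k = 1` or every `k`-district map of `G` is
contractible. -/
theorem switchGraph_connected_iff {V : Type u} [Fintype V] (G : SimpleGraph V)
    (hG : G.Connected) (k : ℕ) (h1 : 1 ≤ k) (hk : k ≤ Nat.card V) :
    (∀ P Q : DistrictMap G k, Relation.ReflTransGen SwitchAdj P Q) ↔
      (k = 1 ∨ ∀ P : DistrictMap G k, ContractibleMap P) := by
  have hGu : SwitchGraph.Conn G Set.univ :=
    SwitchGraph.conn_iff.2 ((SimpleGraph.induceUnivIso G).connected_iff.2 hG)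
  constructor
  · intro hcon
    refine or_iff_not_imp_left.2 fun hk1 P s hs => ?_
    exact SwitchGraph.contractibleDistrict_of_exists_switchable h1
      (fun P s hs => SwitchGraph.exists_switchable hGu (by omega) hk hcon P hs) P hs
  · rintro h P Q
    have hh : ∃ S : Set (Set V), ∀ f : V → Fin k, SwitchGraph.IsCol G f →
        ∃ g, SwitchGraph.Reach G f g ∧ Set.range (SwitchGraph.fib g) = S := by
      rcases h with rfl | h
      · exact SwitchGraph.exists_common_parts_one
      · exact SwitchGraph.exists_common_parts hGu h1 hk h
    exact SwitchGraph.reflTransGen_of_common_parts h1 hh P Q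
end

section
/- Let n, k ∈ ℕ with 2 ≤ k < n, and let G be the path graph with vertices v_1, …, v_n (with v_i adjacent to v_{i+1} for 1 ≤ i < n). Define the k-district maps Π_1 = { {v_1}, {v_2}, …, {v_{k−1}}, {v_k, v_{k+1}, …, v_n} } and Π_2 = { {v_1, …, v_{n−k+1}}, {v_{n−k+2}}, {v_{n−k+3}}, …, {v_n} }. Then Π_1 and Π_2 are contractible k-district maps and every path in the switch graph Γ_k(G) between Π_1 and Π_2 has length at least (k−1)(n−k). In particular, the diameter of Γ_k'(G) is at least (k−1)(n−k). -/
open SimpleGraph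

universe u

/-- The connected vertex sets of a path graph are the nonempty intervals. -/
theorem pathGraph_induce_connected_iff {n : ℕ} {s : Set (Fin n)} :
    ((pathGraph n).induce s).Connected ↔ s.Nonempty ∧ s.OrdConnected := by
  constructor
  · intro h
    refine ⟨Set.nonempty_coe_sort.1 h.nonempty, ⟨fun a ha b hb c hc => ?_⟩⟩
    by_contra hcs
    have below : ∀ x y : s, ((pathGraph n).induce s).Walk x y → x.1 < c → y.1 < c := by
      intro x y p
      induction p with
      | nil => exact id
      | @cons x y z hxy _ ih =>
        intro hx
        apply ih
        have hadj : (pathGraph n).Adj x.1 y.1 := hxy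
        rw [pathGraph_adj] at hadj
        have hyc : y.1 ≠ c := fun h => hcs (h ▸ y.2)
        rw [Fin.ne_iff_vne] at hyc
        rw [Fin.lt_def] at hx ⊢
        omega
    obtain ⟨p⟩ := h.preconnected ⟨a, ha⟩ ⟨b, hb⟩
    have hac : a < c := lt_of_le_of_ne hc.1 fun h => hcs (h ▸ ha)
    exact absurd (below _ _ p hac) (not_lt.2 hc.2)
  · rintro ⟨hne, hs⟩
    have reach : ∀ (d : ℕ) (a b : s), (a.1 : ℕ) + d = b.1 →
        ((pathGraph n).induce s).Reachable a b := by
      intro d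
      induction d with
      | zero =>
        intro a b h
        rw [Subtype.ext (Fin.ext h) (a1 := a) (a2 := b)]
      | succ d ih =>
        intro a b h
        have hcs : (⟨a.1 + 1, by omega⟩ : Fin n) ∈ s :=
          hs.out a.2 b.2 ⟨by rw [Fin.le_def]; exact Nat.le_succ _,
            by rw [Fin.le_def]; change (a.1 : ℕ) + 1 ≤ b.1; omega⟩
        have hadj : ((pathGraph n).induce s).Adj a ⟨_, hcs⟩ := by
          simp [pathGraph_adj]
        exact hadj.reachable.trans (ih _ _ (by simp; omega))
    have := hne.to_subtype
    refine ⟨fun a b => ?_⟩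
    rcases le_total (a.1 : ℕ) b.1 with h | h
    · exact reach ((b.1 : ℕ) - (a.1 : ℕ)) a b (by omega)
    · exact (reach ((a.1 : ℕ) - (b.1 : ℕ)) b a (by omega)).symm

/-- The least vertex of a set of vertices of a path graph, as a natural number. -/
noncomputable def leastVertex {n : ℕ} (s : Set (Fin n)) : ℕ := sInf (Fin.val '' s)

theorem leastVertex_eq {n : ℕ} {s : Set (Fin n)} {a : Fin n} (ha : a ∈ s)
    (hle : ∀ x ∈ s, a ≤ x) : leastVertex s = a :=
  IsLeast.csInf_eq ⟨⟨a, ha, rfl⟩, by rintro _ ⟨x, hx, rfl⟩; exact hle x hx⟩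

section DistrictPotential

variable {n k : ℕ}

/-- The sum of the least vertices of all districts. -/
noncomputable def districtPotential (P : DistrictMap (pathGraph n) k) : ℕ :=
  ∑ᶠ s ∈ P.parts, leastVertex s

/-- Moving `v` from `A` to the adjacent interval `B` changes the sum of the two least vertices
by exactly one. -/
theorem leastVertex_add_switch {A B : Set (Fin n)} (hA : A.OrdConnected) (hB : B.OrdConnected)
    (hAB : Disjoint A B) {u v w : Fin n} (huv : (pathGraph n).Adj u v)
    (hvw : (pathGraph n).Adj v w) (hu : u ∈ A) (hv : v ∈ A) (hw : w ∈ B) :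
    leastVertex (A \ {v}) + leastVertex (insert v B) = leastVertex A + leastVertex B + 1 ∨
    leastVertex (A \ {v}) + leastVertex (insert v B) + 1 = leastVertex A + leastVertex B := by
  have huw : u ≠ w := fun h => Set.disjoint_left.1 hAB hu (h ▸ hw)
  have hwA : w ∉ A := Set.disjoint_right.1 hAB hw
  have hvB : v ∉ B := Set.disjoint_left.1 hAB hv
  rw [pathGraph_adj] at huv hvw
  rw [Fin.ne_iff_vne] at huw
  obtain ⟨a, haA, ha⟩ := Set.exists_min_image A id A.toFinite ⟨u, hu⟩
  obtain ⟨b, hbB, hb⟩ := Set.exists_min_image B id B.toFinite ⟨w, hw⟩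
  simp only [id] at ha hb
  have hau := ha u hu
  have hbw := hb w hw
  rw [leastVertex_eq haA ha, leastVertex_eq hbB hb]
  rw [Fin.le_def] at hau hbw
  rcases huv with huv | huv
  · have hbe : b = w := by
      by_contra hne
      rw [← ne_eq, Fin.ne_iff_vne] at hne
      exact hvB (hB.out hbB hw ⟨by rw [Fin.le_def]; omega, by rw [Fin.le_def]; omega⟩)
    subst hbe
    have hav : a ≠ v := by rw [Fin.ne_iff_vne]; omega
    rw [leastVertex_eq (s := A \ {v}) ⟨haA, hav⟩ fun x hx => ha x hx.1,
      leastVertex_eq (s := insert v B) (Set.mem_insert v B)]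
    · omega
    · rintro x (rfl | hx)
      · exact le_rfl
      · have := hb x hx
        rw [Fin.le_def] at this ⊢
        omega
  · have hae : a = v := by
      have hav := ha v hv
      by_contra hne
      rw [← ne_eq, Fin.ne_iff_vne] at hne
      rw [Fin.le_def] at hav
      exact hwA (hA.out haA hv ⟨by rw [Fin.le_def]; omega, by rw [Fin.le_def]; omega⟩)
    subst hae
    have hua : u ≠ a := by rw [Fin.ne_iff_vne]; omega
    rw [leastVertex_eq (s := A \ {a}) ⟨hu, hua⟩,
      leastVertex_eq (s := insert a B) (Set.mem_insert_of_mem a hbB)]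
    · omega
    · rintro x (rfl | hx)
      · rw [Fin.le_def]
        omega
      · exact hb x hx
    · rintro x ⟨hxA, hxa⟩
      have := ha x hxA
      rw [Set.mem_singleton_iff, ← ne_eq, Fin.ne_iff_vne] at hxa
      rw [Fin.le_def] at this ⊢
      omega

theorem Switch.districtPotential_le {P Q : DistrictMap (pathGraph n) k} (h : Switch P Q) :
    districtPotential Q ≤ districtPotential P + 1 ∧
    districtPotential P ≤ districtPotential Q + 1 := by
  obtain ⟨u, v, w, A, B, huv, hvw, hA, hB, hu, hv, hw, hne, hAne, -, hQ⟩ := h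
  have hdisj : ∀ {s t}, s ∈ P.parts → t ∈ P.parts → s ≠ t → Disjoint s t :=
    fun hs ht hst => P.pairwise_disjoint hs ht hst
  have hAB := hdisj hA hB hne
  have hsplit : P.parts = P.parts \ {A, B} ∪ {A, B} := by
    rw [Set.sdiff_union_of_subset]
    rintro s (rfl | rfl) <;> assumption
  have hne' : A \ {v} ≠ insert v B := fun h =>
    (h ▸ Set.mem_insert v B : v ∈ A \ {v}).2 rfl
  have hdQ : Disjoint (P.parts \ {A, B}) {A \ {v}, insert v B} := by
    rw [Set.disjoint_left]
    rintro s ⟨hs, hsAB⟩ (rfl | rfl)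
    · obtain ⟨x, hx⟩ := hAne
      exact Set.disjoint_left.1 (hdisj hs hA fun h => hsAB (Or.inl h)) hx hx.1
    · exact Set.disjoint_left.1 (hdisj hs hB fun h => hsAB (Or.inr h))
        (Set.mem_insert_of_mem v hw) hw
  have hPsum : districtPotential P = (∑ᶠ s ∈ P.parts \ {A, B}, leastVertex s) +
      (leastVertex A + leastVertex B) := by
    rw [districtPotential, ← finsum_mem_pair hne,
      ← finsum_mem_union Set.disjoint_sdiff_left (Set.toFinite _) (Set.toFinite _), ← hsplit]
  have hQsum : districtPotential Q = (∑ᶠ s ∈ P.parts \ {A, B}, leastVertex s) +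
      (leastVertex (A \ {v}) + leastVertex (insert v B)) := by
    rw [districtPotential, ← finsum_mem_pair hne',
      ← finsum_mem_union hdQ (Set.toFinite _) (Set.toFinite _), ← hQ]
  have := leastVertex_add_switch (pathGraph_induce_connected_iff.1 (P.connected_mem A hA)).2
    (pathGraph_induce_connected_iff.1 (P.connected_mem B hB)).2 hAB huv hvw hu hv hw
  omega

theorem SwitchChain.districtPotential_le {f : ℕ → DistrictMap (pathGraph n) k} {m : ℕ}
    (h : SwitchChain f m) : districtPotential (f m) ≤ districtPotential (f 0) + m := by
  induction m with
  | zero => rfl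
  | succ m ih =>
    have hm := ih fun i hi => h i (hi.trans m.lt_succ_self)
    have hstep : districtPotential (f (m + 1)) ≤ districtPotential (f m) + 1 :=
      (h m m.lt_succ_self).elim (fun hs => hs.districtPotential_le.1)
        fun hs => hs.districtPotential_le.2
    omega

end DistrictPotential

/-- A labelling of the vertices of a path graph, nondecreasing along the path and with labels
exactly `0, …, k - 1`. -/
structure IsDistrictLabelling {n : ℕ} (c : Fin n → ℕ) (k : ℕ) : Prop where
  monotone : Monotone c
  lt : ∀ i, c i < k
  surj : ∀ t < k, ∃ i, c i = t

/-- The vertices with label `t`. -/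
def labelFiber {n : ℕ} (c : Fin n → ℕ) (t : ℕ) : Set (Fin n) := {i | c i = t}

namespace IsDistrictLabelling

variable {n k : ℕ} {c : Fin n → ℕ}

theorem injOn_labelFiber (hc : IsDistrictLabelling c k) :
    Set.InjOn (labelFiber c) (Set.Iio k) := by
  intro s hs t _ hst
  obtain ⟨i, hi⟩ := hc.surj s hs
  have : i ∈ labelFiber c t := hst ▸ hi
  exact hi.symm.trans this

/-- The district map whose districts are the fibers of a labelling. -/
def districtMap (hc : IsDistrictLabelling c k) : DistrictMap (pathGraph n) k where
  parts := labelFiber c '' Set.Iio k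
  ncard_parts := by
    rw [hc.injOn_labelFiber.ncard_image, Set.ncard_eq_toFinset_card']
    simp
  nonempty_mem := by
    rintro _ ⟨t, ht, rfl⟩
    exact hc.surj t ht
  pairwise_disjoint := by
    rintro _ ⟨s, -, rfl⟩ _ ⟨t, -, rfl⟩ hst
    rw [Set.disjoint_left]
    rintro i hs ht
    exact hst (congrArg _ ((Eq.symm hs).trans ht))
  covers v := ⟨labelFiber c (c v), ⟨c v, hc.lt v, rfl⟩, rfl⟩
  connected_mem := by
    rintro _ ⟨t, ht, rfl⟩
    refine pathGraph_induce_connected_iff.2 ⟨hc.surj t ht, ⟨fun a ha b hb x hx => ?_⟩⟩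
    exact le_antisymm ((hc.monotone hx.2).trans_eq hb) (ha.symm.trans_le (hc.monotone hx.1))

theorem districtPotential_eq (hc : IsDistrictLabelling c k) {P : DistrictMap (pathGraph n) k}
    (hP : P.parts = labelFiber c '' Set.Iio k) :
    districtPotential P = ∑ t ∈ Finset.range k, leastVertex (labelFiber c t) := by
  rw [districtPotential, hP, finsum_mem_image hc.injOn_labelFiber, ← Finset.coe_range,
    finsum_mem_coe_finset]

/-- Relabelling the single vertex `v` by the label of its neighbour `w` is a switch. -/
theorem switchOut {c' : Fin n → ℕ} (hc : IsDistrictLabelling c k)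
    (hc' : IsDistrictLabelling c' k) {u v w : Fin n} (huv : (pathGraph n).Adj u v)
    (hvw : (pathGraph n).Adj v w) (hcu : c u = c v) (hcw : c v ≠ c w) (hcv : c' v = c w)
    (heq : ∀ i, i ≠ v → c' i = c i) :
    SwitchOut hc.districtMap hc'.districtMap (labelFiber c (c v)) (labelFiber c' (c v)) := by
  have hne : labelFiber c (c v) ≠ labelFiber c (c w) := fun h =>
    hcw (hc.injOn_labelFiber (hc.lt v) (hc.lt w) h)
  have hmem : labelFiber c' (c v) ∈ hc'.districtMap.parts := ⟨c v, hc.lt v, rfl⟩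
  have hinsert : insert v (labelFiber c (c w)) = labelFiber c' (c w) := by
    ext i
    by_cases hi : i = v
    · subst hi
      simp [labelFiber, hcv]
    · simp [labelFiber, hi, heq i hi]
  have hrest : ∀ t, t ≠ c v → t ≠ c w → labelFiber c t = labelFiber c' t := by
    intro t htv htw
    ext i
    by_cases hi : i = v
    · subst hi
      simp [labelFiber, hcv, htv.symm, htw.symm]
    · simp [labelFiber, heq i hi]
  refine ⟨u, v, w, labelFiber c (c w), huv, hvw, ⟨c v, hc.lt v, rfl⟩, ⟨c w, hc.lt w, rfl⟩,
    hcu, rfl, rfl, hne, ?_, hc'.districtMap.nonempty_mem _ hmem,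
    hc'.districtMap.connected_mem _ hmem, ?_⟩
  · ext i
    by_cases hi : i = v
    · subst hi
      simp [labelFiber, hcv, hcw.symm]
    · simp [labelFiber, hi, heq i hi]
  · rw [hinsert]
    ext s
    constructor
    · rintro ⟨t, ht, rfl⟩
      by_cases htv : t = c v
      · exact Or.inr (Or.inl (by rw [htv]))
      by_cases htw : t = c w
      · exact Or.inr (Or.inr (by rw [htw]; rfl))
      refine Or.inl ⟨⟨t, ht, hrest t htv htw⟩, ?_⟩
      rw [← hrest t htv htw]
      rintro (h | h)
      · exact htv (hc.injOn_labelFiber ht (hc.lt v) h)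
      · exact htw (hc.injOn_labelFiber ht (hc.lt w) h)
    · rintro (⟨⟨t, ht, rfl⟩, hs⟩ | rfl | rfl)
      · have htv : t ≠ c v := by
          rintro rfl
          exact hs (Or.inl rfl)
        have htw : t ≠ c w := by
          rintro rfl
          exact hs (Or.inr rfl)
        exact ⟨t, ht, (hrest t htv htw).symm⟩
      · exact hmem
      · exact ⟨c w, hc.lt w, rfl⟩

/-- A district is contractible if the labels of its vertices other than the last one can be
changed one at a time. -/
theorem contractibleDistrict {c : ℕ → Fin n → ℕ} {t N : ℕ}
    (hc : ∀ j, IsDistrictLabelling (c j) k) {P : DistrictMap (pathGraph n) k} (ht : t < k)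
    (hP : P.parts = labelFiber (c 0) '' Set.Iio k) (hN : (labelFiber (c 0) t).ncard = N + 1)
    (x : Fin n) (hx : labelFiber (c N) t = {x})
    (hstep : ∀ j < N, ∃ u v w : Fin n, (pathGraph n).Adj u v ∧ (pathGraph n).Adj v w ∧
      c j u = t ∧ c j v = t ∧ c j w ≠ t ∧ c (j + 1) v = c j w ∧
      ∀ i, i ≠ v → c (j + 1) i = c j i) :
    ContractibleDistrict P (labelFiber (c 0) t) := by
  refine ⟨x, hP ▸ ⟨t, ht, rfl⟩, fun j => (hc j).districtMap, fun j => labelFiber (c j) t, ?_, rfl,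
    by simpa [hN] using hx, fun j hj => ?_⟩
  · cases P
    simp only at hP
    subst hP
    rfl
  · obtain ⟨u, v, w, huv, hvw, hu, hv, hw, hvw', heq⟩ := hstep j (by omega)
    have := (hc j).switchOut (hc (j + 1)) huv hvw (hu.trans hv.symm)
      (fun h => hw (h.symm.trans hv)) hvw' heq
    rwa [hv] at this

end IsDistrictLabelling

theorem contractibleDistrict_singleton {V : Type u} {G : SimpleGraph V} {k : ℕ}
    {P : DistrictMap G k} {x : V} (hx : {x} ∈ P.parts) : ContractibleDistrict P {x} :=
  ⟨x, hx, fun _ => P, fun _ => {x}, rfl, rfl, rfl, fun i hi => by simp at hi⟩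

/-- The labelling obtained from singletons `0, …, k - 2` and one large last district by moving `j`
vertices from the last district to the preceding one. -/
def rightLabelling (n k j : ℕ) (i : Fin n) : ℕ :=
  if (i : ℕ) < k - 1 + min j (n - k) then min (i : ℕ) (k - 2) else k - 1

/-- The labelling obtained from one large first district and `k - 1` singletons by moving `j`
vertices from the first district to the following one. -/
def leftLabelling (n k j : ℕ) (i : Fin n) : ℕ :=
  if (i : ℕ) ≤ n - k - min j (n - k) then 0 else max 1 ((i : ℕ) - (n - k))

section Labellings

variable {n k : ℕ}

theorem isDistrictLabelling_rightLabelling (h2 : 2 ≤ k) (hk : k < n) (j : ℕ) :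
    IsDistrictLabelling (rightLabelling n k j) k where
  monotone a b hab := by
    rw [Fin.le_def] at hab
    unfold rightLabelling
    split_ifs <;> omega
  lt i := by
    unfold rightLabelling
    split_ifs <;> omega
  surj t ht := by
    rcases Nat.lt_or_ge t (k - 1) with h | h
    · refine ⟨⟨t, by omega⟩, ?_⟩
      unfold rightLabelling
      dsimp only
      split_ifs <;> omega
    · refine ⟨⟨n - 1, by omega⟩, ?_⟩
      unfold rightLabelling
      dsimp only
      split_ifs <;> omega

theorem isDistrictLabelling_leftLabelling (h2 : 2 ≤ k) (hk : k < n) (j : ℕ) :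
    IsDistrictLabelling (leftLabelling n k j) k where
  monotone a b hab := by
    rw [Fin.le_def] at hab
    unfold leftLabelling
    split_ifs <;> omega
  lt i := by
    have := i.2
    unfold leftLabelling
    split_ifs <;> omega
  surj t ht := by
    rcases Nat.eq_zero_or_pos t with h | h
    · refine ⟨⟨0, by omega⟩, ?_⟩
      unfold leftLabelling
      dsimp only
      split_ifs <;> omega
    · refine ⟨⟨n - k + t, by omega⟩, ?_⟩
      unfold leftLabelling
      dsimp only
      split_ifs <;> omega

theorem labelFiber_rightLabelling_zero_of_lt {t : ℕ} (hk : k < n) (ht : t < k - 1) :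
    labelFiber (rightLabelling n k 0) t = {⟨t, by omega⟩} := by
  ext i
  simp only [labelFiber, rightLabelling, Set.mem_ofPred_eq, Set.mem_singleton_iff, Fin.ext_iff]
  split_ifs <;> omega

theorem labelFiber_rightLabelling_zero_last (h2 : 2 ≤ k) :
    labelFiber (rightLabelling n k 0) (k - 1) = {v : Fin n | k - 1 ≤ (v : ℕ)} := by
  ext i
  simp only [labelFiber, rightLabelling, Set.mem_ofPred_eq]
  split_ifs <;> omega

theorem labelFiber_leftLabelling_zero_of_pos {t : ℕ} (ht : 0 < t) (htn : n - k + t < n) :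
    labelFiber (leftLabelling n k 0) t = {⟨n - k + t, htn⟩} := by
  ext i
  simp only [labelFiber, leftLabelling, Set.mem_ofPred_eq, Set.mem_singleton_iff, Fin.ext_iff]
  split_ifs <;> omega

theorem labelFiber_leftLabelling_zero_first :
    labelFiber (leftLabelling n k 0) 0 = {v : Fin n | (v : ℕ) ≤ n - k} := by
  ext i
  simp only [labelFiber, leftLabelling, Set.mem_ofPred_eq]
  split_ifs <;> omega

theorem image_labelFiber_rightLabelling (h2 : 2 ≤ k) (hk : k < n) :
    labelFiber (rightLabelling n k 0) '' Set.Iio k =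
      {s : Set (Fin n) | ∃ i : Fin n, (i : ℕ) < k - 1 ∧ s = {i}} ∪
      {{v : Fin n | k - 1 ≤ (v : ℕ)}} := by
  ext s
  constructor
  · rintro ⟨t, ht, rfl⟩
    rw [Set.mem_Iio] at ht
    rcases Nat.lt_or_ge t (k - 1) with h | h
    · exact Or.inl ⟨_, h, labelFiber_rightLabelling_zero_of_lt hk h⟩
    · obtain rfl : t = k - 1 := by omega
      exact Or.inr (labelFiber_rightLabelling_zero_last h2)
  · rintro (⟨i, hi, rfl⟩ | rfl)
    · exact ⟨i, by rw [Set.mem_Iio]; omega, labelFiber_rightLabelling_zero_of_lt hk hi⟩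
    · exact ⟨k - 1, by rw [Set.mem_Iio]; omega, labelFiber_rightLabelling_zero_last h2⟩

theorem image_labelFiber_leftLabelling (h2 : 2 ≤ k) (hk : k < n) :
    labelFiber (leftLabelling n k 0) '' Set.Iio k =
      {{v : Fin n | (v : ℕ) ≤ n - k}} ∪
      {s : Set (Fin n) | ∃ i : Fin n, n - k + 1 ≤ (i : ℕ) ∧ s = {i}} := by
  ext s
  constructor
  · rintro ⟨t, ht, rfl⟩
    rw [Set.mem_Iio] at ht
    rcases Nat.eq_zero_or_pos t with rfl | h
    · exact Or.inl labelFiber_leftLabelling_zero_first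
    · exact Or.inr ⟨⟨n - k + t, by omega⟩, by simp only; omega,
        labelFiber_leftLabelling_zero_of_pos h _⟩
  · rintro (rfl | ⟨i, hi, rfl⟩)
    · exact ⟨0, by rw [Set.mem_Iio]; omega, labelFiber_leftLabelling_zero_first⟩
    · refine ⟨i - (n - k), by rw [Set.mem_Iio]; omega, ?_⟩
      rw [labelFiber_leftLabelling_zero_of_pos (by omega) (by omega)]
      congr 1
      ext
      simp only
      omega

theorem contractibleMap_of_parts_right (h2 : 2 ≤ k) (hk : k < n)
    {P : DistrictMap (pathGraph n) k}
    (hP : P.parts = labelFiber (rightLabelling n k 0) '' Set.Iio k) : ContractibleMap P := by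
  intro s hs
  obtain ⟨t, ht, rfl⟩ := hP ▸ hs
  rw [Set.mem_Iio] at ht
  rcases Nat.lt_or_ge t (k - 1) with h | h
  · rw [labelFiber_rightLabelling_zero_of_lt hk h] at hs ⊢
    exact contractibleDistrict_singleton hs
  obtain rfl : t = k - 1 := by omega
  refine IsDistrictLabelling.contractibleDistrict (N := n - k)
    (isDistrictLabelling_rightLabelling h2 hk) ht hP ?_ ⟨n - 1, by omega⟩ ?_ fun j hj => ?_
  · rw [labelFiber_rightLabelling_zero_last h2,
      show {v : Fin n | k - 1 ≤ (v : ℕ)} = Set.Ici ⟨k - 1, by omega⟩ from rfl,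
      Set.ncard_eq_toFinset_card', Set.toFinset_Ici, Fin.card_Ici]
    simp only
    omega
  · ext i
    simp only [labelFiber, rightLabelling, Set.mem_ofPred_eq, Set.mem_singleton_iff, Fin.ext_iff]
    split_ifs <;> omega
  · refine ⟨⟨k + j, by omega⟩, ⟨k - 1 + j, by omega⟩, ⟨k - 2 + j, by omega⟩, ?_, ?_, ?_, ?_, ?_,
      ?_, fun i hi => ?_⟩
    · rw [pathGraph_adj]; simp only; omega
    · rw [pathGraph_adj]; simp only; omega
    all_goals
      simp only [rightLabelling, ne_eq, Fin.ext_iff] at *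
      split_ifs <;> omega

theorem contractibleMap_of_parts_left (h2 : 2 ≤ k) (hk : k < n)
    {P : DistrictMap (pathGraph n) k}
    (hP : P.parts = labelFiber (leftLabelling n k 0) '' Set.Iio k) : ContractibleMap P := by
  intro s hs
  obtain ⟨t, ht, rfl⟩ := hP ▸ hs
  rw [Set.mem_Iio] at ht
  rcases Nat.eq_zero_or_pos t with rfl | h
  swap
  · rw [labelFiber_leftLabelling_zero_of_pos h (by omega)] at hs ⊢
    exact contractibleDistrict_singleton hs
  refine IsDistrictLabelling.contractibleDistrict (N := n - k)
    (isDistrictLabelling_leftLabelling h2 hk) ht hP ?_ ⟨0, by omega⟩ ?_ fun j hj => ?_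
  · rw [labelFiber_leftLabelling_zero_first,
      show {v : Fin n | (v : ℕ) ≤ n - k} = Set.Iic ⟨n - k, by omega⟩ from rfl,
      Set.ncard_eq_toFinset_card', Set.toFinset_Iic, Fin.card_Iic]
  · ext i
    simp only [labelFiber, leftLabelling, Set.mem_ofPred_eq, Set.mem_singleton_iff, Fin.ext_iff]
    split_ifs <;> omega
  · refine ⟨⟨n - k - j - 1, by omega⟩, ⟨n - k - j, by omega⟩, ⟨n - k - j + 1, by omega⟩, ?_, ?_,
      ?_, ?_, ?_, ?_, fun i hi => ?_⟩
    · rw [pathGraph_adj]; simp only; omega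
    · exact pathGraph_adj.2 (Or.inl rfl)
    all_goals
      simp only [leftLabelling, ne_eq, Fin.ext_iff] at *
      split_ifs <;> omega

theorem leastVertex_labelFiber_rightLabelling (h2 : 2 ≤ k) (hk : k < n) {t : ℕ} (ht : t < k) :
    leastVertex (labelFiber (rightLabelling n k 0) t) = t := by
  rcases Nat.lt_or_ge t (k - 1) with h | h
  · rw [labelFiber_rightLabelling_zero_of_lt hk h]
    simp [leastVertex]
  · obtain rfl : t = k - 1 := by omega
    rw [labelFiber_rightLabelling_zero_last h2]
    exact leastVertex_eq (a := ⟨k - 1, by omega⟩) (le_refl (k - 1)) fun x hx => hx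

theorem leastVertex_labelFiber_leftLabelling_of_pos {t : ℕ} (ht : 0 < t) (htn : n - k + t < n) :
    leastVertex (labelFiber (leftLabelling n k 0) t) = n - k + t := by
  rw [labelFiber_leftLabelling_zero_of_pos ht htn]
  simp [leastVertex]

theorem leastVertex_labelFiber_leftLabelling_zero (hk : k < n) :
    leastVertex (labelFiber (leftLabelling n k 0) 0) = 0 := by
  rw [labelFiber_leftLabelling_zero_first]
  exact leastVertex_eq (a := ⟨0, by omega⟩) (Nat.zero_le _) fun x _ => Nat.zero_le _

theorem sum_leastVertex_leftLabelling (h2 : 2 ≤ k) (hk : k < n) :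
    ∑ t ∈ Finset.range k, leastVertex (labelFiber (leftLabelling n k 0) t) =
      ∑ t ∈ Finset.range k, leastVertex (labelFiber (rightLabelling n k 0) t) +
        (k - 1) * (n - k) := by
  rw [Finset.sum_congr rfl fun t ht =>
    leastVertex_labelFiber_rightLabelling h2 hk (Finset.mem_range.1 ht)]
  obtain ⟨l, rfl⟩ : ∃ l, k = l + 1 := ⟨k - 1, by omega⟩
  rw [Finset.sum_range_succ', Finset.sum_range_succ',
    leastVertex_labelFiber_leftLabelling_zero hk,
    Finset.sum_congr rfl fun t ht => leastVertex_labelFiber_leftLabelling_of_pos t.succ_pos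
      (by have := Finset.mem_range.1 ht; omega), Finset.sum_add_distrib]
  simp
  ring

end Labellings

/-- On the path graph with `n` vertices, the two contractible `k`-district
maps `Π₁` (singletons at the first `k-1` vertices) and `Π₂` (singletons at the last `k-1`
vertices) are at distance at least `(k-1)(n-k)` in the switch graph. -/
theorem pathGraph_diameter_lower_bound (n k : ℕ) (h2 : 2 ≤ k) (hk : k < n)
    (P₁ P₂ : DistrictMap (SimpleGraph.pathGraph n) k)
    (hP₁ : P₁.parts =
      {s : Set (Fin n) | ∃ i : Fin n, (i : ℕ) < k - 1 ∧ s = {i}} ∪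
      {{v : Fin n | k - 1 ≤ (v : ℕ)}})
    (hP₂ : P₂.parts =
      {{v : Fin n | (v : ℕ) ≤ n - k}} ∪
      {s : Set (Fin n) | ∃ i : Fin n, n - k + 1 ≤ (i : ℕ) ∧ s = {i}}) :
    ContractibleMap P₁ ∧ ContractibleMap P₂ ∧
    ∀ (m : ℕ) (f : ℕ → DistrictMap (SimpleGraph.pathGraph n) k),
      f 0 = P₁ → f m = P₂ → SwitchChain f m → (k - 1) * (n - k) ≤ m := by
  rw [← image_labelFiber_rightLabelling h2 hk] at hP₁
  rw [← image_labelFiber_leftLabelling h2 hk] at hP₂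
  refine ⟨contractibleMap_of_parts_right h2 hk hP₁, contractibleMap_of_parts_left h2 hk hP₂,
    fun m f h0 hm hf => ?_⟩
  have hle := hf.districtPotential_le
  rw [h0, hm, (isDistrictLabelling_rightLabelling h2 hk 0).districtPotential_eq hP₁,
    (isDistrictLabelling_leftLabelling h2 hk 0).districtPotential_eq hP₂,
    sum_leastVertex_leftLabelling h2 hk] at hle
  omega
end

section
/- There exists a constant c > 0 such that for all n, k ∈ ℕ with n ≥ 3 and 2 ≤ k ≤ n, the cycle C_n on n vertices is a biconnected graph for which the diameter of the switch graph Γ_k(C_n) is at least c·k·(n−k). In particular, for every k ≤ n there exists a biconnected graph G with n vertices whose switch graph Γ_k(G) has diameter Ω(k(n−k)). -/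
open SimpleGraph

universe u

/-- The vertices `x` and `y` lie in a common district of `P`. -/
def DistrictMap.Same {V : Type u} {G : SimpleGraph V} {k : ℕ} (P : DistrictMap G k)
    (x y : V) : Prop :=
  ∃ s ∈ P.parts, x ∈ s ∧ y ∈ s

theorem DistrictMap.eq_of_mem {V : Type u} {G : SimpleGraph V} {k : ℕ} (P : DistrictMap G k)
    {s t : Set V} (hs : s ∈ P.parts) (ht : t ∈ P.parts) {x : V} (hxs : x ∈ s) (hxt : x ∈ t) :
    s = t := by
  by_contra h
  exact Set.disjoint_left.1 (P.pairwise_disjoint hs ht h) hxs hxt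

theorem SwitchedAt.same_iff {V : Type u} {G : SimpleGraph V} {k : ℕ} {P Q : DistrictMap G k}
    {u v w : V} (h : SwitchedAt P Q u v w) {x y : V} (hx : x ≠ v) (hy : y ≠ v) :
    Q.Same x y ↔ P.Same x y := by
  obtain ⟨su, sw, -, -, hsu, hsw, -, -, -, -, -, -, hQ⟩ := h
  constructor
  · rintro ⟨s, hs, hxs, hys⟩
    rw [hQ] at hs
    rcases hs with hs | rfl | rfl
    · exact ⟨s, hs.1, hxs, hys⟩
    · exact ⟨su, hsu, hxs.1, hys.1⟩
    · exact ⟨sw, hsw, hxs.resolve_left hx, hys.resolve_left hy⟩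
  · rintro ⟨s, hs, hxs, hys⟩
    unfold DistrictMap.Same
    rw [hQ]
    by_cases h₁ : s = su
    · subst h₁
      exact ⟨s \ {v}, Or.inr (Or.inl rfl), ⟨hxs, hx⟩, hys, hy⟩
    · by_cases h₂ : s = sw
      · subst h₂
        exact ⟨insert v s, Or.inr (Or.inr rfl), Or.inr hxs, Or.inr hys⟩
      · exact ⟨s, Or.inl ⟨hs, by simp [h₁, h₂]⟩, hxs, hys⟩

theorem SwitchedAt.same_and_not {V : Type u} {G : SimpleGraph V} {k : ℕ}
    {P Q : DistrictMap G k} {u v w : V} (h : SwitchedAt P Q u v w) :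
    P.Same u v ∧ ¬ P.Same v w ∧ ¬ Q.Same u v ∧ Q.Same v w := by
  obtain ⟨su, sw, huv, -, hsu, hsw, hu, hv, hw, hne, -, -, hQ⟩ := h
  have hsu' : su \ {v} ∈ Q.parts := by rw [hQ]; exact Or.inr (Or.inl rfl)
  have hsw' : insert v sw ∈ Q.parts := by rw [hQ]; exact Or.inr (Or.inr rfl)
  refine ⟨⟨su, hsu, hu, hv⟩, ?_, ?_, ⟨_, hsw', Or.inl rfl, Or.inr hw⟩⟩
  · rintro ⟨s, hs, hvs, hws⟩
    exact hne ((P.eq_of_mem hsu hs hv hvs).trans (P.eq_of_mem hs hsw hws hw))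
  · rintro ⟨s, hs, hus, hvs⟩
    rw [Q.eq_of_mem hs hsu' hus ⟨hu, huv.ne⟩] at hvs
    exact hvs.2 rfl

section Cycle

variable {n k : ℕ}

open Classical in
/-- The sum of the weights `T x` over the edges `{x - 1, x}` of the cycle joining distinct
districts. -/
noncomputable def boundaryWeight (T : Fin (n + 3) → ℤ)
    (P : DistrictMap (cycleGraph (n + 3)) k) : ℤ :=
  ∑ x, if P.Same (x - 1) x then 0 else T x

open Classical in
theorem abs_boundaryWeight_sub_le_of_switch {T : Fin (n + 3) → ℤ}
    (hT : ∀ x, |T (x + 1) - T x| ≤ 1) {P Q : DistrictMap (cycleGraph (n + 3)) k}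
    (h : Switch P Q) : |boundaryWeight T Q - boundaryWeight T P| ≤ 1 := by
  obtain ⟨u, v, w, h⟩ := h
  have hsame := h.same_and_not
  have hcomm : ∀ (R : DistrictMap (cycleGraph (n + 3)) k) x y, R.Same x y ↔ R.Same y x :=
    fun R x y => ⟨fun ⟨s, hs, hx, hy⟩ => ⟨s, hs, hy, hx⟩, fun ⟨s, hs, hx, hy⟩ => ⟨s, hs, hy, hx⟩⟩
  have hne : v ≠ v + 1 := by simp
  have key : boundaryWeight T Q - boundaryWeight T P =
      ∑ x ∈ {v, v + 1}, ((if Q.Same (x - 1) x then 0 else T x) -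
        (if P.Same (x - 1) x then 0 else T x)) := by
    rw [boundaryWeight, boundaryWeight, ← Finset.sum_sub_distrib]
    refine (Finset.sum_subset (Finset.subset_univ _) fun x _ hx => ?_).symm
    simp only [Finset.mem_insert, Finset.mem_singleton, not_or] at hx
    have := h.same_iff (x := x - 1) (y := x) (fun e => hx.2 (by rw [← e]; simp)) hx.1
    simp [this]
  rw [key, Finset.sum_pair hne]
  have huv : u - v = 1 ∨ v - u = 1 := by
    obtain ⟨_, _, huv, -⟩ := h
    simpa [cycleGraph_adj] using huv
  have hvw : v - w = 1 ∨ w - v = 1 := by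
    obtain ⟨_, _, -, hvw, -⟩ := h
    simpa [cycleGraph_adj] using hvw
  have hTv := hT v
  have huw : u ≠ w := fun e => hsame.2.1 (by rw [← e, hcomm]; exact hsame.1)
  rcases huv with e | e <;> rcases hvw with e' | e'
  · obtain rfl : u = v + 1 := by rw [← e]; abel
    obtain rfl : w = v - 1 := by rw [← e']; abel
    rw [hcomm P (v + 1), hcomm P v (v - 1), hcomm Q (v + 1), hcomm Q v (v - 1)] at hsame
    rw [add_sub_cancel_right, if_pos hsame.2.2.2, if_neg hsame.2.1, if_neg hsame.2.2.1,
      if_pos hsame.1]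
    convert hTv using 2
    ring
  · exact absurd (sub_left_injective (e.trans e'.symm)) huw
  · exact absurd (sub_right_injective (e.trans e'.symm)) huw
  · obtain rfl : w = v + 1 := by rw [← e']; abel
    obtain rfl : u = v - 1 := by rw [← e]; abel
    rw [abs_sub_comm] at hTv
    rw [add_sub_cancel_right, if_neg hsame.2.2.1, if_pos hsame.1, if_pos hsame.2.2.2,
      if_neg hsame.2.1]
    convert hTv using 2
    ring

theorem boundaryWeight_sub_le_of_switchChain {T : Fin (n + 3) → ℤ}
    (hT : ∀ x, |T (x + 1) - T x| ≤ 1) {f : ℕ → DistrictMap (cycleGraph (n + 3)) k} {m : ℕ}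
    (hf : SwitchChain f m) : boundaryWeight T (f m) - boundaryWeight T (f 0) ≤ m := by
  induction m with
  | zero => simp
  | succ m ih =>
    have h₁ := ih fun i hi => hf i (by omega)
    have h₂ : boundaryWeight T (f (m + 1)) - boundaryWeight T (f m) ≤ 1 := by
      rcases hf m (by omega) with h | h
      · exact (abs_le.1 (abs_boundaryWeight_sub_le_of_switch hT h)).2
      · have := (abs_le.1 (abs_boundaryWeight_sub_le_of_switch hT h)).1
        linarith
    push_cast
    linarith

theorem connected_induce_arc (s : Fin (n + 3)) {m : ℕ} (hm : m ≤ n + 2) :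
    ((cycleGraph (n + 3)).induce {x | m ≤ (x + s).val}).Connected := by
  set S : Set (Fin (n + 3)) := {x | m ≤ (x + s).val} with hS
  have hmem : ∀ j : ℕ, m ≤ j → j < n + 3 → (Fin.ofNat (n + 3) j - s) ∈ S := by
    intro j hj hj'
    simp [hS, Nat.mod_eq_of_lt hj', hj]
  have hreach : ∀ j (hj : m ≤ j) (hj' : j < n + 3),
      ((cycleGraph (n + 3)).induce S).Reachable ⟨_, hmem m le_rfl (by omega)⟩
        ⟨_, hmem j hj hj'⟩ := by
    intro j hj
    induction j, hj using Nat.le_induction with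
    | base => intro _; exact Reachable.refl _
    | succ j hj ih =>
      intro hj'
      refine (ih (by omega)).trans (Adj.reachable ?_)
      simp only [comap_adj, Function.Embedding.subtype_apply, cycleGraph_adj]
      right
      rw [sub_sub_sub_cancel_right, sub_eq_iff_eq_add]
      ext
      simp [Fin.val_add, add_comm]
  have : Nonempty S := ⟨⟨_, hmem m le_rfl (by omega)⟩⟩
  refine ⟨fun x y => ?_⟩
  have hx : ∀ x : S, ((cycleGraph (n + 3)).induce S).Reachable
      ⟨_, hmem m le_rfl (by omega)⟩ x := by
    intro x
    convert hreach (x.1 + s).val x.2 (x.1 + s).isLt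
    simp
  exact (hx x).symm.trans (hx y)

theorem biconnected_cycleGraph (n : ℕ) : Biconnected (cycleGraph (n + 3)) := by
  refine ⟨cycleGraph_connected, Or.inr ⟨by simp, fun v => ?_⟩⟩
  have hv : ({v}ᶜ : Set (Fin (n + 3))) = {x | 1 ≤ (x + -v).val} := by
    refine Set.ext fun x => ?_
    rw [Set.mem_compl_iff, Set.mem_singleton_iff, Set.mem_ofPred_eq, Nat.one_le_iff_ne_zero,
      Ne, Fin.val_eq_zero_iff, ← sub_eq_add_neg, sub_eq_zero]
  rw [hv]
  exact connected_induce_arc (-v) (by omega)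

/-- The district map of the cycle, rotated by `s`, whose districts are `k` consecutive
singletons except that the last one is enlarged to an arc covering the rest of the cycle. -/
def arcMap (s : Fin (n + 3)) (hk : 1 ≤ k) (hkn : k ≤ n + 3) :
    DistrictMap (cycleGraph (n + 3)) k where
  parts := (fun c : ℕ => {x | min (x + s).val (k - 1) = c}) '' Set.Iio k
  ncard_parts := by
    rw [Set.InjOn.ncard_image]
    · simp
    · intro c hc d hd h
      rw [Set.mem_Iio] at hc hd
      have := Set.ext_iff.1 h (Fin.ofNat (n + 3) c - s)
      simp only [Set.mem_ofPred_eq, sub_add_cancel, Fin.val_ofNat,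
        Nat.mod_eq_of_lt (show c < n + 3 by omega)] at this
      omega
  nonempty_mem := by
    rintro _ ⟨c, hc, rfl⟩
    rw [Set.mem_Iio] at hc
    exact ⟨Fin.ofNat (n + 3) c - s,
      by simp [Nat.mod_eq_of_lt (show c < n + 3 by omega)]; omega⟩
  pairwise_disjoint := by
    rintro _ ⟨c, -, rfl⟩ _ ⟨d, -, rfl⟩ h
    refine Set.disjoint_left.2 fun x hx hx' => h ?_
    simp only [Set.mem_ofPred_eq] at hx hx'
    rw [← hx, ← hx']
  covers v := ⟨_, ⟨min (v + s).val (k - 1), by rw [Set.mem_Iio]; omega, rfl⟩, rfl⟩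
  connected_mem := by
    rintro _ ⟨c, hc, rfl⟩
    rw [Set.mem_Iio] at hc
    by_cases h : c = k - 1
    · have hs : {x : Fin (n + 3) | min (x + s).val (k - 1) = c} = {x | k - 1 ≤ (x + s).val} := by
        refine Set.ext fun x => ?_
        rw [Set.mem_ofPred_eq, Set.mem_ofPred_eq]
        omega
      dsimp only
      rw [hs]
      exact connected_induce_arc s (by omega)
    · have hs : {x : Fin (n + 3) | min (x + s).val (k - 1) = c} =
          {Fin.ofNat (n + 3) c - s} := by
        refine Set.ext fun x => ?_
        rw [Set.mem_ofPred_eq, Set.mem_singleton_iff, eq_sub_iff_add_eq, Fin.ext_iff,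
          Fin.val_ofNat, Nat.mod_eq_of_lt (show c < n + 3 by omega)]
        omega
      dsimp only
      rw [hs]
      exact Connected.of_subsingleton

theorem arcMap_same_iff (s : Fin (n + 3)) (hk : 1 ≤ k) (hkn : k ≤ n + 3) (x y : Fin (n + 3)) :
    (arcMap s hk hkn).Same x y ↔ min (x + s).val (k - 1) = min (y + s).val (k - 1) := by
  constructor
  · rintro ⟨_, ⟨c, -, rfl⟩, hx, hy⟩
    exact hx.trans hy.symm
  · intro h
    exact ⟨_, ⟨min (x + s).val (k - 1), by rw [Set.mem_Iio]; omega, rfl⟩, rfl, h.symm⟩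

theorem boundaryWeight_arcMap (T : Fin (n + 3) → ℤ) (s : Fin (n + 3)) (hk : 2 ≤ k)
    (hkn : k ≤ n + 3) :
    boundaryWeight T (arcMap s (by omega) hkn) =
      ∑ j ∈ Finset.range k, T (Fin.ofNat (n + 3) j - s) := by
  classical
  have h : ∀ y : Fin (n + 3),
      min (y - 1).val (k - 1) = min y.val (k - 1) ↔ ¬ y.val < k := by
    intro y
    rcases eq_or_ne y 0 with rfl | hy
    · simp
      omega
    · have := Fin.val_sub_one_of_ne_zero hy
      have := Fin.pos_iff_ne_zero.2 hy
      have : 0 < y.val := this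
      omega
  rw [boundaryWeight, ← Equiv.sum_comp (Equiv.subRight s)]
  simp only [arcMap_same_iff, Equiv.subRight_apply]
  have h' : ∀ y : Fin (n + 3), y - s - 1 + s = y - 1 := fun y => by abel
  simp only [h', sub_add_cancel, h, ite_not]
  rw [← Finset.sum_filter]
  refine Finset.sum_bij' (fun y _ => y.val) (fun j _ => Fin.ofNat (n + 3) j) ?_ ?_ ?_ ?_ ?_
  · simp
  · intro j hj
    have := Finset.mem_range.1 hj
    simp [Nat.mod_eq_of_lt (show j < n + 3 by omega), this]
  · simp
  · intro j hj
    have := Finset.mem_range.1 hj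
    simp [Nat.mod_eq_of_lt (show j < n + 3 by omega)]
  · simp

/-- The distance from `x` to `0` along the cycle. -/
def cycleNorm (x : Fin (n + 3)) : ℤ := min (x.val : ℤ) (n + 3 - x.val)

theorem abs_cycleNorm_add_one_sub_le (x : Fin (n + 3)) :
    |cycleNorm (x + 1) - cycleNorm x| ≤ 1 := by
  unfold cycleNorm
  rw [Fin.val_add_one, abs_le]
  have := x.isLt
  split_ifs with h
  · subst h
    simp
    omega
  · push_cast
    omega

theorem two_mul_sum_abs_le (k : ℕ) (c : ℤ) (hc : c = k ∨ c = k - 1) :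
    2 * ∑ j ∈ Finset.range k, |2 * (j : ℤ) - c| ≤ (k : ℤ) ^ 2 + 1 := by
  induction k using Nat.twoStepInduction generalizing c with
  | zero => simp
  | one => rcases hc with rfl | rfl <;> simp
  | more k ih _ =>
    have h := ih (c - 2) (by push_cast at hc; omega)
    have e : ∀ j : ℕ, |2 * ((j + 1 : ℕ) : ℤ) - c| = |2 * (j : ℤ) - (c - 2)| := by
      intro j; push_cast; congr 1; ring
    rw [Finset.sum_range_succ', Finset.sum_congr rfl fun j _ => e j, Finset.sum_range_succ]
    push_cast at hc ⊢
    rw [abs_of_nonneg (show 0 ≤ 2 * (k : ℤ) - (c - 2) by omega),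
      abs_of_nonpos (show 0 - c ≤ 0 by omega)]
    linarith

theorem two_mul_sub_boundaryWeight_arcMap (hk : 2 ≤ k) (hkn : k ≤ n + 3) :
    (k : ℤ) * ((n + 3 : ℕ) - k) - 1 ≤
      2 * (boundaryWeight cycleNorm
          (arcMap (-Fin.ofNat (n + 3) ((n + 4 - k) / 2)) (by omega) hkn) -
        boundaryWeight cycleNorm (arcMap (Fin.ofNat (n + 3) (k / 2)) (by omega) hkn)) := by
  rw [boundaryWeight_arcMap _ _ hk, boundaryWeight_arcMap _ _ hk]
  set a := k / 2 with ha
  set b := (n + 4 - k) / 2 with hb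
  have hlow : ∀ j ∈ Finset.range k,
      2 * cycleNorm (Fin.ofNat (n + 3) j - Fin.ofNat (n + 3) a) ≤ |2 * (j : ℤ) - 2 * a| := by
    intro j hj
    rw [Finset.mem_range] at hj
    unfold cycleNorm
    rw [Fin.val_sub, Fin.val_ofNat, Fin.val_ofNat, Nat.mod_eq_of_lt (show j < n + 3 by omega),
      Nat.mod_eq_of_lt (show a < n + 3 by omega)]
    rcases le_or_gt a j with h | h
    · rw [show n + 3 - a + j = (j - a) + (n + 3) by omega, Nat.add_mod_right,
        Nat.mod_eq_of_lt (by omega), abs_of_nonneg (by omega)]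
      omega
    · rw [Nat.mod_eq_of_lt (by omega), abs_of_neg (by omega)]
      omega
  have hhigh : ∀ j ∈ Finset.range k,
      ((n + 3 : ℕ) : ℤ) - |2 * (j : ℤ) - ((n + 3 : ℕ) - 2 * b)| ≤
        2 * cycleNorm (Fin.ofNat (n + 3) j - -Fin.ofNat (n + 3) b) := by
    intro j hj
    rw [Finset.mem_range] at hj
    unfold cycleNorm
    rw [sub_neg_eq_add, Fin.val_add, Fin.val_ofNat, Fin.val_ofNat,
      Nat.mod_eq_of_lt (show j < n + 3 by omega),
      Nat.mod_eq_of_lt (show b < n + 3 by omega), Nat.mod_eq_of_lt (by omega)]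
    have := le_abs_self (2 * (j : ℤ) - ((n + 3 : ℕ) - 2 * b))
    have := neg_le_abs (2 * (j : ℤ) - ((n + 3 : ℕ) - 2 * b))
    omega
  have h₁ := Finset.sum_le_sum hlow
  have h₂ := Finset.sum_le_sum hhigh
  rw [← Finset.mul_sum] at h₁ h₂
  rw [Finset.sum_sub_distrib] at h₂
  simp only [Finset.sum_const, Finset.card_range, nsmul_eq_mul] at h₂
  have h₃ := two_mul_sum_abs_le k (2 * a) (by omega)
  have h₄ := two_mul_sum_abs_le k ((n + 3 : ℕ) - 2 * b) (by omega)
  nlinarith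

end Cycle

/-- There is a constant `c > 0` such that for all `n ≥ 3` and `2 ≤ k ≤ n`,
the cycle `C_n` is biconnected and the diameter of `Γ_k(C_n)` is at least `c·k·(n-k)`. -/
theorem cycleGraph_diameter_lower_bound :
    ∃ c : ℝ, 0 < c ∧
      ∀ n k : ℕ, 3 ≤ n → 2 ≤ k → k ≤ n →
        Biconnected (SimpleGraph.cycleGraph n) ∧
        ∃ P Q : DistrictMap (SimpleGraph.cycleGraph n) k,
          ∀ (m : ℕ) (f : ℕ → DistrictMap (SimpleGraph.cycleGraph n) k),
            f 0 = P → f m = Q → SwitchChain f m →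
            c * (k : ℝ) * ((n : ℝ) - (k : ℝ)) ≤ (m : ℝ) := by
  refine ⟨1 / 4, by norm_num, fun n k hn hk hkn => ?_⟩
  obtain ⟨n, rfl⟩ := Nat.exists_eq_add_of_le' hn
  refine ⟨biconnected_cycleGraph n, arcMap (Fin.ofNat (n + 3) (k / 2)) (by omega) hkn,
    arcMap (-Fin.ofNat (n + 3) ((n + 4 - k) / 2)) (by omega) hkn, fun m f h₀ hm hf => ?_⟩
  have h₁ := boundaryWeight_sub_le_of_switchChain abs_cycleNorm_add_one_sub_le hf
  have h₂ := two_mul_sub_boundaryWeight_arcMap hk hkn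
  rw [h₀, hm] at h₁
  have h₃ : (k : ℤ) * ((n + 3 : ℕ) - k) ≤ 4 * m := by
    rcases hkn.eq_or_lt with h | h
    · rw [← h]
      simp
    · have : 2 * 1 ≤ (k : ℤ) * ((n + 3 : ℕ) - k) :=
        mul_le_mul (by omega) (by omega) (by omega) (by omega)
      linarith
  have h₄ : (k : ℝ) * ((n + 3 : ℕ) - k) ≤ 4 * m := by exact_mod_cast h₃
  linarith
end
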